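/- arXiv:2401.03438 — 2 statements merged into one kernel-verified Lean document; each statement's English description precedes it below -/
import Mathlib

section
/- Let N be a nonnegative integer and let ν, λ₀, …, λ_m, Λ, a₀, …, a_m be complex numbers with Re ν > −1, −1 < Re λ₀ < Re λ₁ < ⋯ < Re λ_m < Re Λ, N ≤ Re Λ, Re λ₀ ≤ N − 1, and a₀ ≠ 0. Let 0 < ε < 1/3 and let ψ be a smooth function on (0,1) such that ψ^{(k)} is integrable on (1 − 2ε, 1) for 0 ≤ k ≤ N. Let χ₁ be a smooth function on (0,1) with χ₁(t) = 0 for 0 < t ≤ 1 − 2ε and χ₁(t) = 1 for 1 − ε ≤ t < 1, and set φ̃(t) = Σ_{k=0}^{m} a_k (1 − t)^{λ_k} + χ₁(t)(1 − t)^Λ ψ(t) for 0 < t < 1. Then as r → ∞, ∫₀¹ s^{ν+1} φ̃(s²) J_ν(rs) ds = a₀ · (2^{λ₀+1/2}/π^{1/2}) · Γ(λ₀ + 1) · r^{−(λ₀+3/2)} · cos( r − (π/2)(ν + λ₀ + 1) − π/4 ) + o(r^{−Re(λ₀+3/2)}). -/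
open MeasureTheory Filter Set

/-- The Bessel function of the first kind `J_ν(x)`, for `x > 0` defined by the series
`Σ_{k≥0} (-1)^k / (k! Γ(ν+k+1)) (x/2)^{2k+ν}`, powers via the real logarithm of `x/2`. -/
noncomputable def besselJ (ν : ℂ) (x : ℝ) : ℂ :=
  ∑' k : ℕ, ((-1) ^ k / ((Nat.factorial k : ℂ) * Complex.Gamma (ν + k + 1))) *
    ((x / 2 : ℂ) ^ (2 * (k : ℂ) + ν))

/-! ### The entire function `G_ν(z) = ∑ (-1)^k z^k / (k! Γ(ν+k+1))` -/

open Topology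

noncomputable def bcoef (ν : ℂ) (k : ℕ) : ℂ :=
  (-1) ^ k / ((Nat.factorial k : ℂ) * Complex.Gamma (ν + k + 1))

noncomputable def besG (ν z : ℂ) : ℂ := ∑' k : ℕ, bcoef ν k * z ^ k

lemma bcoef_shift (ν : ℂ) (k : ℕ) : bcoef ν k = (ν + k + 1) * bcoef (ν + 1) k := by
  have h := Complex.one_div_Gamma_eq_self_mul_one_div_Gamma_add_one (ν + k + 1)
  have e : ν + k + 1 + 1 = ν + 1 + k + 1 := by ring
  rw [e] at h
  unfold bcoef
  rw [div_eq_mul_inv, div_eq_mul_inv, mul_inv, mul_inv, h]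
  ring

lemma bcoef_succ (ν : ℂ) (k : ℕ) : bcoef ν (k + 1) * ((k : ℂ) + 1) = - bcoef (ν + 1) k := by
  have e : ν + (k + 1 : ℕ) + 1 = ν + 1 + k + 1 := by push_cast; ring
  have hk : (k : ℂ) + 1 ≠ 0 := Nat.cast_add_one_ne_zero k
  unfold bcoef
  rw [e, Nat.factorial_succ]
  push_cast
  rw [div_eq_mul_inv, div_eq_mul_inv, mul_inv, mul_inv, mul_inv, pow_succ]
  field_simp

lemma bcoef_summable (ν z : ℂ) : Summable fun k => bcoef ν k * z ^ k := by
  refine summable_of_ratio_norm_eventually_le (r := 1 / 2) (by norm_num) ?_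
  obtain ⟨M, hM⟩ := exists_nat_gt (2 * ‖z‖ + ‖ν‖ + 1)
  filter_upwards [eventually_ge_atTop M] with k hk
  have hkM : (M : ℝ) ≤ k := by exact_mod_cast hk
  have h1 : bcoef ν k = -((ν + k + 1) * (k + 1)) * bcoef ν (k + 1) := by
    rw [bcoef_shift, ← neg_eq_iff_eq_neg.mpr (bcoef_succ ν k)]; ring
  have h2 : (1 : ℝ) ≤ ‖ν + k + 1‖ := by
    have : ‖(k : ℂ) + 1‖ ≤ ‖ν + k + 1‖ + ‖ν‖ := by
      have h := norm_sub_le (ν + k + 1) ν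
      rwa [show ν + k + 1 - ν = (k : ℂ) + 1 by ring] at h
    have h3 : ‖(k : ℂ) + 1‖ = k + 1 := by
      rw [← Nat.cast_add_one, Complex.norm_natCast]; push_cast; ring
    have := norm_nonneg z
    linarith
  have h3 : ‖(k : ℂ) + 1‖ = k + 1 := by
    rw [← Nat.cast_add_one, Complex.norm_natCast]; push_cast; ring
  rw [h1, pow_succ]
  simp only [norm_mul, norm_neg, h3]
  have h4 : 2 * ‖z‖ ≤ ‖ν + k + 1‖ * (k + 1) := by
    have := norm_nonneg z
    have := norm_nonneg ν
    nlinarith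
  have h5 : 0 ≤ ‖bcoef ν (k + 1)‖ * ‖z ^ k‖ := by positivity
  nlinarith [mul_le_mul_of_nonneg_left h4 h5]

lemma besG_hasDerivAt (ν z : ℂ) : HasDerivAt (besG ν) (-besG (ν + 1) z) z := by
  have hs : Summable fun k : ℕ => ‖bcoef ν k‖ * (k * (‖z‖ + 1) ^ (k - 1)) := by
    rw [← summable_nat_add_iff 1]
    have := (bcoef_summable (ν + 1) ((‖z‖ + 1 : ℝ) : ℂ)).norm
    refine this.congr fun k => ?_
    have h := congrArg norm (bcoef_succ ν k)
    have h3 : ‖(k : ℂ) + 1‖ = k + 1 := by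
      rw [← Nat.cast_add_one, Complex.norm_natCast]; push_cast; ring
    rw [norm_mul, norm_neg, h3] at h
    rw [norm_mul, ← h, norm_pow, Complex.norm_real, Real.norm_of_nonneg (by positivity)]
    rw [Nat.add_sub_cancel]
    push_cast
    ring
  have h := hasDerivAt_tsum_of_isPreconnected (𝕜 := ℂ) (F := ℂ)
    (g := fun (k : ℕ) (w : ℂ) => bcoef ν k * w ^ k)
    (g' := fun (k : ℕ) (w : ℂ) => bcoef ν k * (k * w ^ (k - 1)))
    (t := Metric.ball 0 (‖z‖ + 1)) (y₀ := 0) (y := z) hs Metric.isOpen_ball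
    (convex_ball _ _).isPreconnected
    (fun n y _ => (hasDerivAt_pow n y).const_mul _)
    (fun n y hy => by
      have hy' : ‖y‖ ≤ ‖z‖ + 1 := by simpa using (mem_ball_zero_iff.mp hy).le
      rw [norm_mul, norm_mul, norm_pow, Complex.norm_natCast]
      gcongr)
    (by simp; positivity) (bcoef_summable ν 0) (by simp)
  refine h.congr_deriv ?_
  have hs' : Summable fun k : ℕ => bcoef ν k * (k * z ^ (k - 1)) := by
    refine Summable.of_norm_bounded hs fun n => ?_
    rw [norm_mul, norm_mul, norm_pow, Complex.norm_natCast]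
    gcongr
    linarith [norm_nonneg z]
  rw [hs'.tsum_eq_zero_add]
  simp only [besG, CharP.cast_eq_zero, zero_mul, mul_zero, zero_add]
  rw [← tsum_neg]
  refine tsum_congr fun k => ?_
  have := bcoef_succ ν k
  push_cast
  linear_combination (z ^ k) * this

lemma besG_rec (μ z : ℂ) : besG μ z = (μ + 1) * besG (μ + 1) z - z * besG (μ + 2) z := by
  have h1 := (bcoef_summable (μ + 1) z)
  have h2 := (bcoef_summable (μ + 2) z)
  have hs : Summable fun k : ℕ => (k : ℂ) * bcoef (μ + 1) k * z ^ k := by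
    have : (fun k : ℕ => (k : ℂ) * bcoef (μ + 1) k * z ^ k)
      = fun k => bcoef μ k * z ^ k - (μ + 1) * (bcoef (μ + 1) k * z ^ k) := by
      ext k; rw [bcoef_shift μ k]; ring
    rw [this]
    exact (bcoef_summable μ z).sub (h1.mul_left _)
  have h3 : ∑' k : ℕ, (k : ℂ) * bcoef (μ + 1) k * z ^ k = - (z * besG (μ + 2) z) := by
    rw [hs.tsum_eq_zero_add]
    simp only [besG, CharP.cast_eq_zero, zero_mul, zero_add]
    rw [← tsum_mul_left, ← tsum_neg]
    congr 1; ext k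
    have := bcoef_succ (μ + 1) k
    rw [show μ + 1 + 1 = μ + 2 by ring] at this
    push_cast
    rw [pow_succ]
    linear_combination (z ^ k * z) * this
  have h4 : besG μ z = (∑' k : ℕ, (μ + 1) * (bcoef (μ + 1) k * z ^ k)) +
      ∑' k : ℕ, (k : ℂ) * bcoef (μ + 1) k * z ^ k := by
    rw [← (h1.mul_left _).tsum_add hs, besG]
    congr 1; ext k
    rw [bcoef_shift μ k]; ring
  rw [h4, h3, tsum_mul_left]
  change (μ + 1) * besG (μ + 1) z + _ = _
  ring

lemma besG_continuous (ν : ℂ) : Continuous (besG ν) :=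
  continuous_iff_continuousAt.mpr fun z => (besG_hasDerivAt ν z).continuousAt

lemma besselJ_eq (ν : ℂ) {x : ℝ} (hx : 0 < x) :
    besselJ ν x = ((x / 2 : ℝ) : ℂ) ^ ν * besG ν ((x ^ 2 / 4 : ℝ) : ℂ) := by
  unfold besselJ besG
  rw [← tsum_mul_left]
  congr 1; ext k
  have hx2 : ((x : ℂ) / 2) ≠ 0 := by
    have : (x : ℂ) ≠ 0 := by exact_mod_cast hx.ne'
    exact div_ne_zero this two_ne_zero
  rw [Complex.cpow_add _ _ hx2, show (2 * (k : ℂ)) = ((2 * k : ℕ) : ℂ) by push_cast; ring,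
    Complex.cpow_natCast, pow_mul, bcoef]
  push_cast
  rw [div_pow]; ring

/-- derivative of `t^(ν+1) G_{ν+1}(z t)`. -/
lemma besG_hasDerivAt_pow (ν z : ℂ) {t : ℝ} (ht : 0 < t) :
    HasDerivAt (fun t : ℝ => (t : ℂ) ^ (ν + 1) * besG (ν + 1) (z * t))
      ((t : ℂ) ^ ν * besG ν (z * t)) t := by
  have ht0 : (t : ℂ) ≠ 0 := by exact_mod_cast ht.ne'
  have h1 : HasDerivAt (fun w : ℂ => w ^ (ν + 1)) ((ν + 1) * (t : ℂ) ^ (ν + 1 - 1)) (t : ℂ) := by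
    have := (hasDerivAt_id (t : ℂ)).cpow_const (c := ν + 1) (Or.inl (by simpa using ht))
    simpa using this
  have h2 : HasDerivAt (fun w : ℂ => besG (ν + 1) (z * w)) (-besG (ν + 1 + 1) (z * t) * z) (t : ℂ) := by
    have h0 : HasDerivAt (fun w : ℂ => z * w) z (t : ℂ) := by
      simpa using (hasDerivAt_id (t : ℂ)).const_mul z
    exact (besG_hasDerivAt (ν + 1) (z * t)).comp (t : ℂ) h0
  have h3 := (h1.mul h2).comp_ofReal
  refine h3.congr_deriv ?_
  rw [besG_rec ν (z * t), add_sub_cancel_right, Complex.cpow_add _ _ ht0, Complex.cpow_one,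
    show ν + 1 + 1 = ν + 2 by ring]
  ring


/-! ### Sonine's integral -/

lemma beta_integrableOn {ν l : ℂ} (hν : -1 < ν.re) (hl : -1 < l.re) :
    IntegrableOn (fun t : ℝ => (t : ℂ) ^ ν * ((1 - t : ℝ) : ℂ) ^ l) (Ioo 0 1) := by
  have h := Complex.betaIntegral_convergent (u := ν + 1) (v := l + 1)
    (by simp; linarith) (by simp; linarith)
  rw [intervalIntegrable_iff_integrableOn_Ioo_of_le zero_le_one] at h
  simpa using h

lemma beta_besG_integrableOn {ν l : ℂ} (hν : -1 < ν.re) (hl : -1 < l.re) (z : ℂ) :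
    IntegrableOn (fun t : ℝ => (t : ℂ) ^ ν * ((1 - t : ℝ) : ℂ) ^ l * besG ν (z * t)) (Ioo 0 1) := by
  have hc : Continuous fun t : ℝ => besG ν (z * t) := (besG_continuous ν).comp (by fun_prop)
  obtain ⟨C, hC⟩ := isCompact_Icc.exists_bound_of_continuousOn (s := Icc (0:ℝ) 1) hc.continuousOn
  refine Integrable.mul_bdd (c := C) (beta_integrableOn hν hl) hc.aestronglyMeasurable ?_
  exact (ae_restrict_iff' measurableSet_Ioo).mpr
    (Eventually.of_forall fun t ht => hC t (Ioo_subset_Icc_self ht))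

lemma sonine {ν l : ℂ} (hν : -1 < ν.re) (hl : -1 < l.re) (z : ℂ) :
    ∫ t in Ioo (0:ℝ) 1, (t : ℂ) ^ ν * ((1 - t : ℝ) : ℂ) ^ l * besG ν (z * t)
      = Complex.Gamma (l + 1) * besG (ν + l + 1) z := by
  have hb := beta_integrableOn hν hl
  set b : ℝ → ℂ := fun t : ℝ => (t : ℂ) ^ ν * ((1 - t : ℝ) : ℂ) ^ l with hbdef
  set F : ℕ → ℝ → ℂ := fun k t => b t * (bcoef ν k * (z * t) ^ k) with hF
  have hFi : ∀ k, Integrable (F k) (volume.restrict (Ioo 0 1)) := by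
    intro k
    have hc : Continuous fun t : ℝ => bcoef ν k * (z * t) ^ k := by fun_prop
    obtain ⟨C, hC⟩ := isCompact_Icc.exists_bound_of_continuousOn (s := Icc (0:ℝ) 1) hc.continuousOn
    refine Integrable.mul_bdd (c := C) hb hc.aestronglyMeasurable ?_
    exact (ae_restrict_iff' measurableSet_Ioo).mpr
      (Eventually.of_forall fun t ht => hC t (Ioo_subset_Icc_self ht))
  have hsum : Summable fun k => ∫ t in Ioo (0:ℝ) 1, ‖F k t‖ := by
    refine Summable.of_nonneg_of_le (fun k => integral_nonneg fun t => norm_nonneg _) (fun k => ?_)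
      (((bcoef_summable ν z).norm).mul_left (∫ t in Ioo (0:ℝ) 1, ‖b t‖))
    rw [← integral_mul_const]
    refine setIntegral_mono_on (hFi k).norm (hb.norm.mul_const _) measurableSet_Ioo fun t ht => ?_
    simp only [hF]
    rw [norm_mul]
    refine mul_le_mul_of_nonneg_left ?_ (norm_nonneg _)
    rw [norm_mul, norm_mul, mul_pow, norm_mul]
    have : ‖(t : ℂ) ^ k‖ ≤ 1 := by
      rw [norm_pow, Complex.norm_real, Real.norm_of_nonneg ht.1.le]
      exact pow_le_one₀ ht.1.le ht.2.le
    gcongr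
    exact mul_le_of_le_one_right (norm_nonneg _) this
  have h := hasSum_integral_of_summable_integral_norm hFi hsum
  have hterm : ∀ k, ∫ t in Ioo (0:ℝ) 1, F k t
      = Complex.Gamma (l + 1) * (bcoef (ν + l + 1) k * z ^ k) := by
    intro k
    have hre1 : 0 < (ν + k + 1).re := by
      have : (0:ℝ) ≤ k := Nat.cast_nonneg k
      simp; linarith
    have hre2 : 0 < (l + 1).re := by simp; linarith
    have hre3 : 0 < (ν + l + 1 + k + 1).re := by
      have : (0:ℝ) ≤ k := Nat.cast_nonneg k
      simp at hre1 hre2 ⊢; linarith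
    have hB := Complex.Gamma_mul_Gamma_eq_betaIntegral hre1 hre2
    have hBe : ∫ t in Ioo (0:ℝ) 1, F k t = bcoef ν k * z ^ k * (ν + k + 1).betaIntegral (l + 1) := by
      rw [Complex.betaIntegral, intervalIntegral.integral_of_le zero_le_one,
        integral_Ioc_eq_integral_Ioo, ← integral_const_mul]
      refine setIntegral_congr_fun measurableSet_Ioo fun t ht => ?_
      have ht0 : (t : ℂ) ≠ 0 := by exact_mod_cast ht.1.ne'
      simp only [hF, hbdef, add_sub_cancel_right]
      rw [Complex.cpow_add _ _ ht0, Complex.cpow_natCast]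
      push_cast
      ring
    rw [hBe]
    have g1 := Complex.Gamma_ne_zero_of_re_pos hre1
    have g3 := Complex.Gamma_ne_zero_of_re_pos hre3
    have hkf : (Nat.factorial k : ℂ) ≠ 0 := by exact_mod_cast Nat.factorial_ne_zero k
    rw [show ν + k + 1 + (l + 1) = ν + l + 1 + k + 1 by ring] at hB
    have hB' : (ν + k + 1).betaIntegral (l + 1) = Complex.Gamma (ν + k + 1) * Complex.Gamma (l + 1)
      / Complex.Gamma (ν + l + 1 + k + 1) := by
      rw [hB]; field_simp
    rw [hB']
    simp only [bcoef]
    field_simp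
  simp only [hterm] at h
  have h2 := h.tsum_eq
  rw [tsum_mul_left] at h2
  rw [besG, h2]
  refine setIntegral_congr_fun measurableSet_Ioo fun t ht => ?_
  simp only [hF, hbdef, besG, tsum_mul_left]


/-! ### Poisson's integral -/

lemma besG_neg_half (w : ℂ) : besG (-1 / 2) (w ^ 2 / 4) = Complex.cos w / ((√Real.pi : ℝ) : ℂ) := by
  have hpi : ((√Real.pi : ℝ) : ℂ) ≠ 0 := by
    exact_mod_cast (Real.sqrt_pos.mpr Real.pi_pos).ne'
  have h := (Complex.hasSum_cos w).div_const ((√Real.pi : ℝ) : ℂ)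
  rw [← h.tsum_eq, besG]
  refine tsum_congr fun k => ?_
  have hd := Complex.Gamma_mul_Gamma_add_half ((k : ℂ) + 1 / 2)
  rw [show (k : ℂ) + 1 / 2 + 1 / 2 = k + 1 by ring, Complex.Gamma_nat_eq_factorial,
    show 2 * ((k : ℂ) + 1 / 2) = ((2 * k : ℕ) : ℂ) + 1 by push_cast; ring,
    Complex.Gamma_nat_eq_factorial,
    show (1 : ℂ) - (((2 * k : ℕ) : ℂ) + 1) = -((2 * k : ℕ) : ℂ) by ring,
    Complex.cpow_neg, Complex.cpow_natCast, pow_mul] at hd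
  have hkf : (Nat.factorial k : ℂ) ≠ 0 := by exact_mod_cast Nat.factorial_ne_zero k
  have h2kf : (Nat.factorial (2 * k) : ℂ) ≠ 0 := by exact_mod_cast Nat.factorial_ne_zero (2 * k)
  have hg : Complex.Gamma (-1 / 2 + k + 1) = Nat.factorial (2 * k) * ((2 : ℂ) ^ 2)⁻¹ ^ k *
      ((√Real.pi : ℝ) : ℂ) / Nat.factorial k := by
    rw [show (-1 / 2 + k + 1 : ℂ) = k + 1 / 2 by ring, eq_div_iff hkf, hd, inv_pow]
  rw [bcoef, hg, show (2 : ℂ) ^ 2 = 4 by norm_num, div_pow, pow_mul, inv_pow]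
  have h4 : (4 : ℂ) ^ k ≠ 0 := pow_ne_zero _ (by norm_num)
  field_simp

lemma integral_sq_sub (g : ℝ → ℂ) :
    ∫ t in Ioo (0:ℝ) 1, g t = ∫ s in Ioo (0:ℝ) 1, (2 * s) • g (s ^ 2) := by
  have him : (fun s : ℝ => s ^ 2) '' Ioo 0 1 = Ioo 0 1 := by
    ext t; constructor
    · rintro ⟨s, ⟨h0, h1⟩, rfl⟩
      exact ⟨by positivity, by nlinarith⟩
    · rintro ⟨h0, h1⟩
      refine ⟨√t, ⟨Real.sqrt_pos.mpr h0, ?_⟩, Real.sq_sqrt h0.le⟩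
      rw [Real.sqrt_lt' one_pos]; simpa
  have hinj : InjOn (fun s : ℝ => s ^ 2) (Ioo 0 1) := by
    intro a ha b hb hab
    exact (pow_left_inj₀ ha.1.le hb.1.le two_ne_zero).mp hab
  have h := integral_image_eq_integral_abs_deriv_smul (f := fun s : ℝ => s ^ 2)
    (f' := fun s => 2 * s) measurableSet_Ioo
    (fun x _ => by simpa using (hasDerivAt_pow 2 x).hasDerivWithinAt) hinj g
  rw [him] at h
  rw [h]
  refine setIntegral_congr_fun measurableSet_Ioo fun s hs => ?_
  rw [abs_of_pos (by have := hs.1; positivity)]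

lemma integrable_sq_sub (g : ℝ → ℂ) (hg : IntegrableOn g (Ioo 0 1)) :
    IntegrableOn (fun s : ℝ => (2 * s) • g (s ^ 2)) (Ioo 0 1) := by
  have him : (fun s : ℝ => s ^ 2) '' Ioo 0 1 = Ioo 0 1 := by
    ext t; constructor
    · rintro ⟨s, ⟨h0, h1⟩, rfl⟩
      exact ⟨by positivity, by nlinarith⟩
    · rintro ⟨h0, h1⟩
      refine ⟨√t, ⟨Real.sqrt_pos.mpr h0, ?_⟩, Real.sq_sqrt h0.le⟩
      rw [Real.sqrt_lt' one_pos]; simpa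
  have hinj : InjOn (fun s : ℝ => s ^ 2) (Ioo 0 1) := by
    intro a ha b hb hab
    exact (pow_left_inj₀ ha.1.le hb.1.le two_ne_zero).mp hab
  have h := integrableOn_image_iff_integrableOn_abs_deriv_smul (f := fun s : ℝ => s ^ 2)
    (f' := fun s => 2 * s) measurableSet_Ioo
    (fun x _ => by simpa using (hasDerivAt_pow 2 x).hasDerivWithinAt) hinj g
  rw [him] at h
  refine (h.mp hg).congr_fun (fun s hs => ?_) measurableSet_Ioo
  simp only
  rw [abs_of_pos (by have := hs.1; positivity)]

lemma poisson {l : ℂ} (hl : -1 < l.re) (r : ℝ) :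
    Complex.Gamma (l + 1) * besG (l + 1 / 2) ((r ^ 2 / 4 : ℝ) : ℂ)
      = (2 / ((√Real.pi : ℝ) : ℂ)) *
        ∫ s in Ioo (0:ℝ) 1, ((1 - s ^ 2 : ℝ) : ℂ) ^ l * Complex.cos (r * s) := by
  have h := sonine (ν := -1 / 2) (l := l) (by norm_num) hl ((r ^ 2 / 4 : ℝ) : ℂ)
  rw [show -1 / 2 + l + 1 = l + 1 / 2 by ring] at h
  rw [← h, integral_sq_sub, ← integral_const_mul]
  refine setIntegral_congr_fun measurableSet_Ioo fun s hs => ?_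
  have hs0 : (s : ℂ) ≠ 0 := by exact_mod_cast hs.1.ne'
  have h1 : besG (-1 / 2) (((r ^ 2 / 4 : ℝ) : ℂ) * ((s ^ 2 : ℝ) : ℂ))
      = Complex.cos (r * s) / ((√Real.pi : ℝ) : ℂ) := by
    rw [← besG_neg_half]; congr 1; push_cast; ring
  have h2 : ((s ^ 2 : ℝ) : ℂ) ^ (-1 / 2 : ℂ) = (s : ℂ)⁻¹ := by
    rw [show (-1 / 2 : ℂ) = ((-1 / 2 : ℝ) : ℂ) by push_cast; ring,
      ← Complex.ofReal_cpow (by positivity), ← Real.rpow_natCast s 2, ← Real.rpow_mul hs.1.le]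
    norm_num
    rw [Real.rpow_neg_one]; simp
  simp only [h1, h2, Complex.real_smul]
  push_cast
  field_simp

lemma poisson_exp {l : ℂ} (hl : 0 < l.re) (r : ℝ) :
    ∫ s in (-1:ℝ)..1, (1 - (s : ℂ) ^ 2) ^ l * Complex.exp (Complex.I * r * s)
      = 2 * ∫ s in Ioo (0:ℝ) 1, ((1 - s ^ 2 : ℝ) : ℂ) ^ l * Complex.cos (r * s) := by
  set f : ℝ → ℂ := fun s => (1 - (s : ℂ) ^ 2) ^ l * Complex.exp (Complex.I * r * s) with hf
  have hc : ContinuousOn f (Icc (-1) 1) := by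
    intro s hs
    apply ContinuousAt.continuousWithinAt
    have h1 : ContinuousAt (fun w : ℂ => w ^ l) (1 - (s : ℂ) ^ 2) := by
      apply Complex.continuousAt_cpow_const_of_re_pos _ hl
      left
      have : (1 - (s : ℂ) ^ 2) = ((1 - s ^ 2 : ℝ) : ℂ) := by push_cast; ring
      rw [this, Complex.ofReal_re]
      nlinarith [hs.1, hs.2]
    have h2 : ContinuousAt (fun s : ℝ => 1 - (s : ℂ) ^ 2) s := by fun_prop
    exact (ContinuousAt.comp (f := fun s : ℝ => 1 - (s : ℂ) ^ 2) h1 h2).mul (by fun_prop)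
  have hi1 : IntervalIntegrable f volume (-1) 0 :=
    (hc.mono (by rw [uIcc_of_le (by norm_num)]; exact Icc_subset_Icc le_rfl (by norm_num))).intervalIntegrable
  have hi2 : IntervalIntegrable f volume 0 1 :=
    (hc.mono (by rw [uIcc_of_le (by norm_num)]; exact Icc_subset_Icc (by norm_num) le_rfl)).intervalIntegrable
  have hi3 : IntervalIntegrable (fun s => f (-s)) volume 0 1 := by
    apply ContinuousOn.intervalIntegrable
    rw [uIcc_of_le (by norm_num)]
    refine hc.comp (by fun_prop) fun s hs => ?_
    exact ⟨by linarith [hs.2], by linarith [hs.1]⟩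
  have hn : ∫ s in (-1:ℝ)..0, f s = ∫ s in (0:ℝ)..1, f (-s) := by
    rw [intervalIntegral.integral_comp_neg]; simp
  rw [← intervalIntegral.integral_add_adjacent_intervals hi1 hi2, hn,
    ← intervalIntegral.integral_add hi3 hi2, intervalIntegral.integral_of_le zero_le_one,
    integral_Ioc_eq_integral_Ioo, ← integral_const_mul]
  refine setIntegral_congr_fun measurableSet_Ioo fun s hs => ?_
  simp only [hf, Complex.cos]
  push_cast
  rw [neg_sq, show Complex.I * r * -s = -(r * s) * Complex.I by ring,
    show Complex.I * r * s = r * s * Complex.I by ring]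
  ring


/-! ### Asymptotics of the Bessel function -/

lemma vert_tendsto {l c : ℂ} (hl : 0 < l.re) (hc : c.im ≠ 0) :
    Tendsto (fun r : ℝ => (r : ℂ) ^ (l + 1) *
      ∫ y in (0:ℝ)..1, (y * (y + c)) ^ l * Complex.exp (-(r * y))) atTop
      (𝓝 (Complex.Gamma (l + 1) * c ^ l)) := by
  have hslit : ∀ y : ℝ, (y + c : ℂ) ∈ Complex.slitPlane := fun y => by
    rw [Complex.mem_slitPlane_iff]; right; simpa using hc
  have hcont : Continuous fun y : ℝ => (y + c : ℂ) ^ l := by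
    rw [continuous_iff_continuousAt]
    intro y
    have h1 : ContinuousAt (fun w : ℂ => w ^ l) (y + c) := continuousAt_cpow_const (hslit y)
    exact ContinuousAt.comp (f := fun y : ℝ => (y + c : ℂ)) h1 (by fun_prop)
  obtain ⟨C, hC⟩ := isCompact_Icc.exists_bound_of_continuousOn (s := Icc (0:ℝ) 1) hcont.continuousOn
  set g : ℝ → ℂ := fun u => (Real.exp (-u) : ℂ) * (u : ℂ) ^ l with hg
  have hgi : IntegrableOn g (Ioi 0) := by
    have := Complex.GammaIntegral_convergent (s := l + 1) (by simp; linarith)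
    simpa [hg] using this
  have hG : Complex.Gamma (l + 1) = ∫ u in Ioi (0:ℝ), g u := by
    rw [Complex.Gamma_eq_integral (by simp; linarith), Complex.GammaIntegral]
    simp [hg]
  have hlim : Tendsto (fun r : ℝ => ∫ u in Ioi (0:ℝ),
      (Ioc 0 r).indicator (fun u => g u * ((u / r : ℝ) + c) ^ l) u) atTop
      (𝓝 (∫ u in Ioi (0:ℝ), g u * c ^ l)) := by
    refine tendsto_integral_filter_of_dominated_convergence (fun u => ‖g u‖ * C) ?_ ?_ ?_ ?_
    · refine Eventually.of_forall fun r => ?_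
      refine AEStronglyMeasurable.indicator ?_ measurableSet_Ioc
      refine hgi.aestronglyMeasurable.mul ?_
      exact (hcont.comp (by fun_prop : Continuous fun u : ℝ => u / r)).aestronglyMeasurable
    · filter_upwards [eventually_gt_atTop 0] with r hr
      refine Eventually.of_forall fun u => ?_
      by_cases hu : u ∈ Ioc 0 r
      · rw [indicator_of_mem hu, norm_mul]
        refine mul_le_mul_of_nonneg_left (hC _ ⟨?_, ?_⟩) (norm_nonneg _)
        · exact div_nonneg hu.1.le hr.le
        · exact (div_le_one hr).mpr hu.2
      · rw [indicator_of_notMem hu, norm_zero]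
        have : 0 ≤ C := (norm_nonneg _).trans (hC 0 (by simp))
        positivity
    · exact hgi.norm.mul_const C
    · refine (ae_restrict_iff' measurableSet_Ioi).mpr (Eventually.of_forall fun u hu => ?_)
      have h1 : Tendsto (fun r : ℝ => u / r) atTop (𝓝 0) := tendsto_const_nhds.div_atTop tendsto_id
      have h2 := (hcont.tendsto 0).comp h1
      simp only [Complex.ofReal_zero, zero_add] at h2
      refine (h2.const_mul (g u)).congr' ?_
      filter_upwards [eventually_ge_atTop u] with r hr
      rw [indicator_of_mem (show u ∈ Ioc 0 r from ⟨hu, hr⟩)]; rfl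
  rw [integral_mul_const, ← hG] at hlim
  refine hlim.congr' ?_
  filter_upwards [eventually_gt_atTop 0] with r hr
  have hr0 : (r : ℂ) ≠ 0 := by exact_mod_cast hr.ne'
  rw [setIntegral_indicator measurableSet_Ioc,
    show Ioi (0:ℝ) ∩ Ioc 0 r = Ioc 0 r from inter_eq_right.mpr Ioc_subset_Ioi_self,
    ← intervalIntegral.integral_of_le hr.le]
  have hsub := intervalIntegral.integral_comp_div (a := 0) (b := r) (c := r)
    (fun y : ℝ => ((y : ℂ) * (y + c)) ^ l * Complex.exp (-(r * y))) hr.ne'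
  rw [zero_div, div_self hr.ne', Complex.real_smul] at hsub
  rw [Complex.cpow_add _ _ hr0, Complex.cpow_one, mul_assoc, ← hsub,
    ← intervalIntegral.integral_const_mul, intervalIntegral.integral_of_le hr.le,
    intervalIntegral.integral_of_le hr.le]
  refine setIntegral_congr_fun measurableSet_Ioc fun u hu => ?_
  have hur : 0 < u / r := div_pos hu.1 hr
  have hne : ((u / r : ℝ) + c : ℂ) ≠ 0 := Complex.slitPlane_ne_zero (hslit _)
  have hmul : (((u / r : ℝ) : ℂ) * ((u / r : ℝ) + c)) ^ l
      = ((u / r : ℝ) : ℂ) ^ l * ((u / r : ℝ) + c) ^ l := by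
    have hur0 : ((u / r : ℝ) : ℂ) ≠ 0 := by exact_mod_cast hur.ne'
    rw [Complex.cpow_def_of_ne_zero (mul_ne_zero hur0 hne), Complex.log_ofReal_mul hur hne,
      Complex.cpow_def_of_ne_zero hur0, Complex.cpow_def_of_ne_zero hne, add_mul, Complex.exp_add,
      Complex.ofReal_log hur.le]
  have hu' : (u : ℂ) ^ l = (r : ℂ) ^ l * ((u / r : ℝ) : ℂ) ^ l := by
    rw [← Complex.mul_cpow_ofReal_nonneg hr.le hur.le]
    congr 1; push_cast; field_simp
  simp only [hg]
  rw [hmul, hu']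
  have : (-(r * ((u / r : ℝ) : ℂ)) : ℂ) = ((-u : ℝ) : ℂ) := by push_cast; field_simp
  rw [this, Complex.ofReal_exp]
  ring

lemma contour {l : ℂ} (hl : 0 < l.re) (r : ℝ) :
    ∫ s in (-1:ℝ)..1, (1 - (s : ℂ) ^ 2) ^ l * Complex.exp (Complex.I * r * s)
      = Complex.I * Complex.exp (-(Complex.I * r)) *
          (∫ y in (0:ℝ)..1, ((y:ℂ) * (y + 2 * Complex.I)) ^ l * Complex.exp (-(r * y)))
        - Complex.I * Complex.exp (Complex.I * r) *
          (∫ y in (0:ℝ)..1, ((y:ℂ) * (y + -(2 * Complex.I))) ^ l * Complex.exp (-(r * y)))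
        + Complex.exp (-r) *
          ∫ s in (-1:ℝ)..1, (1 - ((s : ℂ) + Complex.I) ^ 2) ^ l * Complex.exp (Complex.I * r * s) := by
  set f : ℂ → ℂ := fun w => (1 - w ^ 2) ^ l * Complex.exp (Complex.I * r * w) with hf
  have hre : ∀ w : ℂ, (1 - w ^ 2).re = 1 - w.re ^ 2 + w.im ^ 2 := fun w => by
    simp [sq]; ring
  have h := Complex.integral_boundary_rect_eq_zero_of_continuousOn_of_differentiableOn f
    (-1) (1 + Complex.I) ?_ ?_
  · simp only [Complex.neg_re, Complex.one_re, Complex.add_re, Complex.I_re, Complex.neg_im,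
      Complex.one_im, Complex.add_im, Complex.I_im, neg_zero, add_zero, zero_add,
      Complex.ofReal_zero, zero_mul, Complex.ofReal_one, one_mul, Complex.ofReal_neg,
      smul_eq_mul] at h
    have e1 : ∫ x in (-1:ℝ)..1, f ((x:ℂ) + Complex.I) = Complex.exp (-r) *
          ∫ s in (-1:ℝ)..1, (1 - ((s : ℂ) + Complex.I) ^ 2) ^ l * Complex.exp (Complex.I * r * s) := by
      rw [← intervalIntegral.integral_const_mul]
      refine intervalIntegral.integral_congr fun s _ => ?_
      simp only [hf]
      rw [show Complex.I * r * (s + Complex.I) = -r + Complex.I * r * s by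
        linear_combination (r : ℂ) * Complex.I_mul_I, Complex.exp_add]
      ring
    have e2 : ∫ y in (0:ℝ)..1, f (1 + y * Complex.I) = Complex.exp (Complex.I * r) *
          ∫ y in (0:ℝ)..1, ((y:ℂ) * (y + -(2 * Complex.I))) ^ l * Complex.exp (-(r * y)) := by
      rw [← intervalIntegral.integral_const_mul]
      refine intervalIntegral.integral_congr fun y _ => ?_
      simp only [hf]
      rw [show Complex.I * r * (1 + y * Complex.I) = Complex.I * r + -(r * y) by
        linear_combination (r * y : ℂ) * Complex.I_mul_I, Complex.exp_add,
        show (1 - (1 + y * Complex.I) ^ 2 : ℂ) = y * (y + -(2 * Complex.I)) by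
        linear_combination (-y ^ 2 : ℂ) * Complex.I_mul_I]
      ring
    have e3 : ∫ y in (0:ℝ)..1, f (-1 + y * Complex.I) = Complex.exp (-(Complex.I * r)) *
          ∫ y in (0:ℝ)..1, ((y:ℂ) * (y + 2 * Complex.I)) ^ l * Complex.exp (-(r * y)) := by
      rw [← intervalIntegral.integral_const_mul]
      refine intervalIntegral.integral_congr fun y _ => ?_
      simp only [hf]
      rw [show Complex.I * r * (-1 + y * Complex.I) = -(Complex.I * r) + -(r * y) by
        linear_combination (r * y : ℂ) * Complex.I_mul_I, Complex.exp_add,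
        show (1 - (-1 + y * Complex.I) ^ 2 : ℂ) = y * (y + 2 * Complex.I) by
        linear_combination (-y ^ 2 : ℂ) * Complex.I_mul_I]
      ring
    rw [e1, e2, e3] at h
    simp only [hf] at h
    linear_combination h
  · intro w hw
    apply ContinuousAt.continuousWithinAt
    have hw' : -1 ≤ w.re ∧ w.re ≤ 1 := by
      have := (Complex.mem_reProdIm.mp hw).1
      rw [uIcc_of_le (by simp)] at this
      simpa using this
    have h1 : ContinuousAt (fun w : ℂ => w ^ l) (1 - w ^ 2) := by
      apply Complex.continuousAt_cpow_const_of_re_pos _ hl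
      left
      rw [hre]; nlinarith [sq_nonneg w.im]
    exact (ContinuousAt.comp (f := fun w : ℂ => 1 - w ^ 2) h1 (by fun_prop)).mul (by fun_prop)
  · intro w hw
    apply DifferentiableAt.differentiableWithinAt
    have hw' : -1 < w.re ∧ w.re < 1 := by
      have := (Complex.mem_reProdIm.mp hw).1
      rw [min_eq_left (by simp), max_eq_right (by simp)] at this
      simpa using this
    refine DifferentiableAt.mul (DifferentiableAt.cpow_const (by fun_prop) ?_) (by fun_prop)
    rw [Complex.mem_slitPlane_iff]
    left
    rw [hre]; nlinarith [sq_nonneg w.im]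


lemma cos_bdd (c : ℂ) : ∃ C : ℝ, ∀ x : ℝ, ‖Complex.cos (x - c)‖ ≤ C := by
  refine ⟨‖Complex.exp (-c * Complex.I)‖ + ‖Complex.exp (c * Complex.I)‖, fun x => ?_⟩
  have h1 : Complex.exp ((x - c) * Complex.I)
      = Complex.exp (x * Complex.I) * Complex.exp (-c * Complex.I) := by
    rw [← Complex.exp_add]; congr 1; ring
  have h2 : Complex.exp (-(x - c) * Complex.I)
      = Complex.exp ((-x : ℝ) * Complex.I) * Complex.exp (c * Complex.I) := by
    rw [← Complex.exp_add]; congr 1; push_cast; ring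
  rw [Complex.cos, h1, h2, norm_div]
  refine (div_le_self (norm_nonneg _) (by simp)).trans ((norm_add_le _ _).trans ?_)
  rw [norm_mul, norm_mul, Complex.norm_exp_ofReal_mul_I, Complex.norm_exp_ofReal_mul_I]
  simp

def BesAsy (μ : ℂ) : Prop :=
  Tendsto (fun x : ℝ => ((√x : ℝ) : ℂ) * besselJ μ x -
    ((√(2 / Real.pi) : ℝ) : ℂ) * Complex.cos (x - (Real.pi / 2 * μ + Real.pi / 4))) atTop (𝓝 0)

lemma top_tendsto (l : ℂ) (hl : 0 < l.re) :
    Tendsto (fun r : ℝ => (r : ℂ) ^ (l + 1) * (Complex.exp (-r) *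
      ∫ s in (-1:ℝ)..1, (1 - ((s : ℂ) + Complex.I) ^ 2) ^ l * Complex.exp (Complex.I * r * s)))
      atTop (𝓝 0) := by
  have hcont : ContinuousOn (fun s : ℝ => (1 - ((s : ℂ) + Complex.I) ^ 2) ^ l) (Icc (-1) 1) := by
    intro s hs
    apply ContinuousAt.continuousWithinAt
    have h1 : ContinuousAt (fun w : ℂ => w ^ l) (1 - ((s : ℂ) + Complex.I) ^ 2) := by
      apply Complex.continuousAt_cpow_const_of_re_pos _ hl
      left
      simp [sq]; nlinarith [hs.1, hs.2]
    exact ContinuousAt.comp (f := fun s : ℝ => 1 - ((s : ℂ) + Complex.I) ^ 2) h1 (by fun_prop)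
  obtain ⟨C, hC⟩ := isCompact_Icc.exists_bound_of_continuousOn hcont
  have hb : ∀ r : ℝ, ‖∫ s in (-1:ℝ)..1, (1 - ((s : ℂ) + Complex.I) ^ 2) ^ l *
      Complex.exp (Complex.I * r * s)‖ ≤ C * |1 - (-1)| := by
    intro r
    refine intervalIntegral.norm_integral_le_of_norm_le_const fun s hs => ?_
    rw [uIoc_of_le (by norm_num)] at hs
    rw [norm_mul, show Complex.I * r * s = ((r * s : ℝ) : ℂ) * Complex.I by push_cast; ring,
      Complex.norm_exp_ofReal_mul_I, mul_one]
    exact hC s (Ioc_subset_Icc_self hs)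
  have hz := (tendsto_rpow_mul_exp_neg_mul_atTop_nhds_zero (l.re + 1) 1 one_pos).mul_const
    (C * |1 - (-1)|)
  rw [zero_mul] at hz
  refine squeeze_zero_norm' ?_ hz
  filter_upwards [eventually_gt_atTop 0] with r hr
  rw [norm_mul, norm_mul, Complex.norm_cpow_eq_rpow_re_of_pos hr, ← mul_assoc]
  have he : ‖Complex.exp (-(r : ℂ))‖ = Real.exp (-1 * r) := by
    rw [Complex.norm_exp]; simp
  rw [he, Complex.add_re, Complex.one_re]
  exact mul_le_mul_of_nonneg_left (hb r) (by positivity)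

lemma besAsy_base {l : ℂ} (hl : 0 < l.re) : BesAsy (l + 1 / 2) := by
  have hG : Complex.Gamma (l + 1) ≠ 0 := Complex.Gamma_ne_zero_of_re_pos (by simp; linarith)
  have hpi : ((√Real.pi : ℝ) : ℂ) ≠ 0 := by
    exact_mod_cast (Real.sqrt_pos.mpr Real.pi_pos).ne'
  have h2l : (2 : ℂ) ^ l ≠ 0 := by simp [Complex.cpow_eq_zero_iff]
  have hs2 : ((√2 : ℝ) : ℂ) ≠ 0 := by
    exact_mod_cast (Real.sqrt_pos.mpr two_pos).ne'
  have hs22 : ((√2 : ℝ) : ℂ) * ((√2 : ℝ) : ℂ) = 2 := by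
    exact_mod_cast Real.mul_self_sqrt zero_le_two
  have hsqrt : ∀ x : ℝ, 0 ≤ x → (x : ℂ) ^ (1 / 2 : ℂ) = ((√x : ℝ) : ℂ) := by
    intro x hx
    rw [Real.sqrt_eq_rpow, Complex.ofReal_cpow hx]; norm_num
  set K : ℂ := 1 / ((2 : ℂ) ^ l * ((√2 : ℝ) : ℂ) * ((√Real.pi : ℝ) : ℂ) * Complex.Gamma (l + 1)) with hK
  set Vp : ℝ → ℂ := fun r =>
    ∫ y in (0:ℝ)..1, ((y:ℂ) * (y + 2 * Complex.I)) ^ l * Complex.exp (-(r * y)) with hVp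
  set Vm : ℝ → ℂ := fun r =>
    ∫ y in (0:ℝ)..1, ((y:ℂ) * (y + -(2 * Complex.I))) ^ l * Complex.exp (-(r * y)) with hVm
  set T : ℝ → ℂ := fun r => Complex.exp (-r) *
      ∫ s in (-1:ℝ)..1, (1 - ((s : ℂ) + Complex.I) ^ 2) ^ l * Complex.exp (Complex.I * r * s) with hT
  have hTt : Tendsto (fun r : ℝ => (r : ℂ) ^ (l + 1) * T r) atTop (𝓝 0) := top_tendsto l hl
  have hp : Tendsto (fun r : ℝ => (r : ℂ) ^ (l + 1) * Vp r) atTop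
      (𝓝 (Complex.Gamma (l + 1) * (2 * Complex.I) ^ l)) := vert_tendsto hl (by simp)
  have hm : Tendsto (fun r : ℝ => (r : ℂ) ^ (l + 1) * Vm r) atTop
      (𝓝 (Complex.Gamma (l + 1) * (-(2 * Complex.I)) ^ l)) := vert_tendsto hl (by simp)
  have hp' := tendsto_sub_nhds_zero_iff.mpr hp
  have hm' := tendsto_sub_nhds_zero_iff.mpr hm
  have key : ∀ x : ℝ, 0 < x → ((√x : ℝ) : ℂ) * besselJ (l + 1 / 2) x -
    ((√(2 / Real.pi) : ℝ) : ℂ) * Complex.cos (x - (Real.pi / 2 * (l + 1 / 2) + Real.pi / 4))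
    = K * (Complex.I * Complex.exp (-(Complex.I * x)) *
        ((x : ℂ) ^ (l + 1) * Vp x - Complex.Gamma (l + 1) * (2 * Complex.I) ^ l)
       - Complex.I * Complex.exp (Complex.I * x) *
        ((x : ℂ) ^ (l + 1) * Vm x - Complex.Gamma (l + 1) * (-(2 * Complex.I)) ^ l)
       + (x : ℂ) ^ (l + 1) * T x) := by
    intro x hx
    have hx0 : (x : ℂ) ≠ 0 := by exact_mod_cast hx.ne'
    have hP := poisson (l := l) (by linarith) x
    have hPe := poisson_exp hl x
    rw [contour hl x] at hPe
    change Complex.I * Complex.exp (-(Complex.I * x)) * Vp x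
      - Complex.I * Complex.exp (Complex.I * x) * Vm x + T x = _ at hPe
    have hJ : ((√x : ℝ) : ℂ) * besselJ (l + 1 / 2) x = K * ((x : ℂ) ^ (l + 1) *
      (Complex.I * Complex.exp (-(Complex.I * x)) * Vp x
      - Complex.I * Complex.exp (Complex.I * x) * Vm x + T x)) := by
      rw [besselJ_eq _ hx, hPe]
      have hb : besG (l + 1 / 2) ((x ^ 2 / 4 : ℝ) : ℂ) = (2 / ((√Real.pi : ℝ) : ℂ)) *
        (∫ s in Ioo (0:ℝ) 1, ((1 - s ^ 2 : ℝ) : ℂ) ^ l * Complex.cos (x * s)) /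
          Complex.Gamma (l + 1) := by
        rw [← hP]; field_simp
      have hxx : ((√x : ℝ) : ℂ) * ((x / 2 : ℝ) : ℂ) ^ (l + 1 / 2) =
          (x : ℂ) ^ (l + 1) / ((2 : ℂ) ^ l * ((√2 : ℝ) : ℂ)) := by
        have e1 : ((x / 2 : ℝ) : ℂ) ^ (l + 1 / 2) * ((2 : ℝ) : ℂ) ^ (l + 1 / 2)
          = (x : ℂ) ^ (l + 1 / 2) := by
          rw [← Complex.mul_cpow_ofReal_nonneg (by positivity) zero_le_two]
          congr 1; push_cast; field_simp
        have e2 : ((2 : ℝ) : ℂ) ^ (l + 1 / 2) = (2 : ℂ) ^ l * ((√2 : ℝ) : ℂ) := by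
          rw [Complex.cpow_add _ _ (by norm_num), hsqrt 2 zero_le_two]; norm_num
        have e3 : (x : ℂ) ^ (l + 1) = (x : ℂ) ^ (l + 1 / 2) * ((√x : ℝ) : ℂ) := by
          rw [← hsqrt x hx.le, ← Complex.cpow_add _ _ hx0]; congr 1; ring
        rw [e2] at e1
        rw [e3, ← e1]
        field_simp
      rw [← mul_assoc, hxx, hb, hK]
      field_simp
    have hC : ((√(2 / Real.pi) : ℝ) : ℂ) * Complex.cos (x - (Real.pi / 2 * (l + 1 / 2) + Real.pi / 4))
      = K * (Complex.I * Complex.exp (-(Complex.I * x)) * (Complex.Gamma (l + 1) * (2 * Complex.I) ^ l)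
       - Complex.I * Complex.exp (Complex.I * x) *
        (Complex.Gamma (l + 1) * (-(2 * Complex.I)) ^ l)) := by
      have hI : Complex.I ≠ 0 := Complex.I_ne_zero
      have c1 : (2 * Complex.I) ^ l = (2 : ℂ) ^ l * Complex.exp (Real.pi / 2 * Complex.I * l) := by
        have := Complex.log_ofReal_mul (r := 2) two_pos hI
        rw [Complex.cpow_def_of_ne_zero (by simp), Complex.cpow_def_of_ne_zero (by simp)]
        push_cast at this
        rw [this, Complex.log_I, ← Complex.exp_add]
        congr 1; rw [Complex.ofReal_log zero_le_two]; push_cast; ring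
      have c2 : (-(2 * Complex.I)) ^ l = (2 : ℂ) ^ l * Complex.exp (-(Real.pi / 2 * Complex.I * l)) := by
        have := Complex.log_ofReal_mul (r := 2) two_pos (neg_ne_zero.mpr hI)
        rw [Complex.cpow_def_of_ne_zero (by simp), Complex.cpow_def_of_ne_zero (by simp)]
        push_cast at this
        rw [← mul_neg, this, Complex.log_neg_I, ← Complex.exp_add]
        congr 1; rw [Complex.ofReal_log zero_le_two]; push_cast; ring
      have c3 : ((√(2 / Real.pi) : ℝ) : ℂ) = 2 / (((√2 : ℝ) : ℂ) * ((√Real.pi : ℝ) : ℂ)) := by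
        rw [Real.sqrt_div zero_le_two]
        push_cast
        rw [← hs22]; field_simp
      have hpI : Complex.exp (Real.pi / 2 * Complex.I) = Complex.I := Complex.exp_pi_div_two_mul_I
      have hpI' : Complex.exp (-(Real.pi / 2 * Complex.I)) = -Complex.I := by
        rw [Complex.exp_neg, hpI, Complex.inv_I]
      have c4 : Complex.cos (x - (Real.pi / 2 * (l + 1 / 2) + Real.pi / 4))
        = (-Complex.I * Complex.exp (Complex.I * x) * Complex.exp (-(Real.pi / 2 * Complex.I * l)) +
          Complex.I * Complex.exp (-(Complex.I * x)) * Complex.exp (Real.pi / 2 * Complex.I * l)) / 2 := by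
        have d1 : Complex.exp ((x - (Real.pi / 2 * (l + 1 / 2) + Real.pi / 4)) * Complex.I)
            = Complex.exp (-(Real.pi / 2 * Complex.I)) * Complex.exp (Complex.I * x) *
              Complex.exp (-(Real.pi / 2 * Complex.I * l)) := by
          simp only [← Complex.exp_add]
          congr 1; ring
        have d2 : Complex.exp (-(x - (Real.pi / 2 * (l + 1 / 2) + Real.pi / 4)) * Complex.I)
            = Complex.exp (Real.pi / 2 * Complex.I) * Complex.exp (-(Complex.I * x)) *
              Complex.exp (Real.pi / 2 * Complex.I * l) := by
          simp only [← Complex.exp_add]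
          congr 1; ring
        rw [Complex.cos, d1, d2, hpI, hpI']
      rw [c1, c2, c3, c4, hK]
      field_simp
      ring
    rw [hJ, hC]; ring
  have hb1 : IsBoundedUnder (· ≤ ·) atTop fun x : ℝ => ‖Complex.I * Complex.exp (-(Complex.I * x))‖ := by
    refine isBoundedUnder_of ⟨1, fun x => ?_⟩
    rw [norm_mul, show -(Complex.I * x) = ((-x : ℝ) : ℂ) * Complex.I by push_cast; ring,
      Complex.norm_exp_ofReal_mul_I]; simp
  have hb2 : IsBoundedUnder (· ≤ ·) atTop fun x : ℝ => ‖Complex.I * Complex.exp (Complex.I * x)‖ := by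
    refine isBoundedUnder_of ⟨1, fun x => ?_⟩
    rw [norm_mul, mul_comm Complex.I (x:ℂ), Complex.norm_exp_ofReal_mul_I]; simp
  have hfin := (((isBoundedUnder_le_mul_tendsto_zero hb1 hp').sub (isBoundedUnder_le_mul_tendsto_zero hb2 hm')).add hTt).const_mul K
  simp only [sub_zero, add_zero, mul_zero] at hfin
  refine hfin.congr' ?_
  filter_upwards [eventually_gt_atTop 0] with x hx
  exact (key x hx).symm

lemma besselJ_rec (μ : ℂ) {x : ℝ} (hx : 0 < x) :
    besselJ μ x = (2 * (μ + 1)) / x * besselJ (μ + 1) x - besselJ (μ + 2) x := by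
  have hx0 : (x : ℂ) ≠ 0 := by exact_mod_cast hx.ne'
  have hx2 : ((x / 2 : ℝ) : ℂ) ≠ 0 := by exact_mod_cast (half_pos hx).ne'
  rw [besselJ_eq _ hx, besselJ_eq _ hx, besselJ_eq _ hx, besG_rec μ,
    Complex.cpow_add _ 1 hx2, Complex.cpow_add _ 2 hx2, Complex.cpow_one,
    show (2 : ℂ) = ((2 : ℕ) : ℂ) by norm_num, Complex.cpow_natCast]
  push_cast
  field_simp
  ring

lemma BesAsy.bdd {μ : ℂ} (h : BesAsy μ) :
    ∃ C : ℝ, ∀ᶠ x : ℝ in atTop, ‖((√x : ℝ) : ℂ) * besselJ μ x‖ ≤ C := by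
  obtain ⟨C, hC⟩ := cos_bdd (Real.pi / 2 * μ + Real.pi / 4)
  refine ⟨1 + ‖((√(2 / Real.pi) : ℝ) : ℂ)‖ * C, ?_⟩
  have h1 := (tendsto_zero_iff_norm_tendsto_zero.mp h).eventually_le_const one_pos
  filter_upwards [h1] with x hx
  have := norm_add_le (((√x : ℝ) : ℂ) * besselJ μ x -
    ((√(2 / Real.pi) : ℝ) : ℂ) * Complex.cos (x - (Real.pi / 2 * μ + Real.pi / 4)))
    (((√(2 / Real.pi) : ℝ) : ℂ) * Complex.cos (x - (Real.pi / 2 * μ + Real.pi / 4)))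
  rw [sub_add_cancel] at this
  refine this.trans (add_le_add hx ?_)
  rw [norm_mul]
  exact mul_le_mul_of_nonneg_left (hC x) (norm_nonneg _)

lemma besAsy_down {μ : ℂ} (h1 : BesAsy (μ + 1)) (h2 : BesAsy (μ + 2)) : BesAsy μ := by
  obtain ⟨C, hC⟩ := h1.bdd
  have hz : Tendsto (fun x : ℝ => (2 * (μ + 1)) / (x : ℂ)) atTop (𝓝 0) := by
    have h3 : Tendsto (fun x : ℝ => ((x⁻¹ : ℝ) : ℂ)) atTop (𝓝 ((0 : ℝ) : ℂ)) :=
      (Complex.continuous_ofReal.tendsto 0).comp tendsto_inv_atTop_zero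
    have := h3.const_mul (2 * (μ + 1))
    simpa [div_eq_mul_inv] using this
  have hb : IsBoundedUnder (· ≤ ·) atTop fun x : ℝ => ‖((√x : ℝ) : ℂ) * besselJ (μ + 1) x‖ :=
    ⟨C, by simpa using hC⟩
  have hfin := (hz.zero_mul_isBoundedUnder_le hb).sub h2
  simp only [sub_zero] at hfin
  refine hfin.congr' ?_
  filter_upwards [eventually_gt_atTop 0] with x hx
  rw [besselJ_rec μ hx]
  have hcos : Complex.cos (x - (Real.pi / 2 * (μ + 2) + Real.pi / 4))
    = - Complex.cos (x - (Real.pi / 2 * μ + Real.pi / 4)) := by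
    rw [← Complex.cos_sub_pi]; congr 1; ring
  rw [hcos]; ring

theorem besAsy (μ : ℂ) : BesAsy μ := by
  have h : ∀ n : ℕ, ∀ μ : ℂ, 1 / 2 - (n : ℝ) < μ.re → BesAsy μ := by
    intro n
    induction n with
    | zero =>
      intro μ hμ
      have := besAsy_base (l := μ - 1 / 2) (by simp at hμ ⊢; linarith)
      simpa using this
    | succ n ih =>
      intro μ hμ
      push_cast at hμ
      exact besAsy_down (ih _ (by simp; linarith)) (ih _ (by simp; linarith))
  obtain ⟨n, hn⟩ := exists_nat_gt (1 / 2 - μ.re)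
  exact h n μ (by linarith)


/-! ### The remainder integral -/

lemma integrableOn_mul_cont {g q : ℝ → ℂ} (hg : IntegrableOn g (Ioo 0 1)) (hq : Continuous q) :
    IntegrableOn (fun t => g t * q t) (Ioo 0 1) := by
  obtain ⟨C, hC⟩ := isCompact_Icc.exists_bound_of_continuousOn (s := Icc (0:ℝ) 1) hq.continuousOn
  refine Integrable.mul_bdd (c := C) hg hq.aestronglyMeasurable ?_
  exact (ae_restrict_iff' measurableSet_Ioo).mpr
    (Eventually.of_forall fun t ht => hC t (Ioo_subset_Icc_self ht))

lemma maxpow_cont {δ : ℝ} (hδ : 0 < δ) (μ : ℂ) :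
    Continuous fun s : ℝ => ((max s δ : ℝ) : ℂ) ^ μ := by
  rw [continuous_iff_continuousAt]
  intro s
  have h1 : ContinuousAt (fun w : ℂ => w ^ μ) ((max s δ : ℝ) : ℂ) := by
    apply continuousAt_cpow_const
    rw [Complex.ofReal_mem_slitPlane]
    exact lt_max_of_lt_right hδ
  have h2 : ContinuousAt (fun s : ℝ => ((max s δ : ℝ) : ℂ)) s := by
    apply Continuous.continuousAt
    exact Complex.continuous_ofReal.comp (by fun_prop)
  exact ContinuousAt.comp (f := fun s : ℝ => ((max s δ : ℝ) : ℂ)) h1 h2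

lemma integrableOn_besG {g : ℝ → ℂ} {δ : ℝ} (hδ : 0 < δ) (hg : IntegrableOn g (Ioo 0 1))
    (hv : ∀ t, 0 < t → t ≤ δ → g t = 0) (ν μ z : ℂ) :
    IntegrableOn (fun t : ℝ => (t : ℂ) ^ ν * g t * besG μ (z * t)) (Ioo 0 1) := by
  have hq : Continuous fun t : ℝ => ((max t δ : ℝ) : ℂ) ^ ν * besG μ (z * t) :=
    (maxpow_cont hδ ν).mul ((besG_continuous μ).comp (by fun_prop))
  refine (integrableOn_mul_cont hg hq).congr_fun (fun t ht => ?_) measurableSet_Ioo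
  simp only
  by_cases h : t ≤ δ
  · simp [hv t ht.1 h]
  · rw [max_eq_left (not_le.mp h).le]; ring

lemma riemann_lebesgue {k : ℝ → ℂ} :
    Tendsto (fun r : ℝ => ∫ s in Ioo (0:ℝ) 1, k s * Complex.exp (r * s * Complex.I)) atTop (𝓝 0) ∧
    Tendsto (fun r : ℝ => ∫ s in Ioo (0:ℝ) 1, k s * Complex.exp (-(r * s * Complex.I))) atTop (𝓝 0) := by
  have h := Real.tendsto_integral_exp_smul_cocompact ((Ioo (0:ℝ) 1).indicator k)
  have hpi : 0 < 2 * Real.pi := by positivity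
  have h1 : Tendsto (fun r : ℝ => r / (2 * Real.pi)) atTop (cocompact ℝ) :=
    (tendsto_id.atTop_div_const hpi).mono_right atTop_le_cocompact
  have h2 : Tendsto (fun r : ℝ => -(r / (2 * Real.pi))) atTop (cocompact ℝ) :=
    (tendsto_neg_atTop_atBot.comp (tendsto_id.atTop_div_const hpi)).mono_right atBot_le_cocompact
  constructor
  · refine (h.comp h2).congr fun r => ?_
    simp only [Function.comp]
    rw [← integral_indicator measurableSet_Ioo]
    refine integral_congr_ae (Eventually.of_forall fun s => ?_)
    simp only [indicator]
    split_ifs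
    · rw [Circle.smul_def, Real.fourierChar_apply, smul_eq_mul, mul_comm]
      congr 2
      push_cast
      field_simp
    · simp
  · refine (h.comp h1).congr fun r => ?_
    simp only [Function.comp]
    rw [← integral_indicator measurableSet_Ioo]
    refine integral_congr_ae (Eventually.of_forall fun s => ?_)
    simp only [indicator]
    split_ifs
    · rw [Circle.smul_def, Real.fourierChar_apply, smul_eq_mul, mul_comm]
      congr 2
      push_cast
      field_simp
    · simp

lemma riemann_lebesgue_cos {k : ℝ → ℂ} (hk : IntegrableOn k (Ioo 0 1)) (d : ℂ) :
    Tendsto (fun r : ℝ => ∫ s in Ioo (0:ℝ) 1, k s * Complex.cos ((r * s : ℝ) - d)) atTop (𝓝 0) := by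
  obtain ⟨h1, h2⟩ := riemann_lebesgue (k := k)
  have h3 := (h1.const_mul (Complex.exp (-(d * Complex.I)) / 2)).add
    (h2.const_mul (Complex.exp (d * Complex.I) / 2))
  simp only [mul_zero, add_zero] at h3
  refine h3.congr fun r => ?_
  rw [← integral_const_mul, ← integral_const_mul, ← integral_add]
  · refine setIntegral_congr_fun measurableSet_Ioo fun s hs => ?_
    have e1 : Complex.exp (((r * s : ℝ) - d) * Complex.I)
        = Complex.exp (r * s * Complex.I) * Complex.exp (-(d * Complex.I)) := by
      rw [← Complex.exp_add]; congr 1; push_cast; ring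
    have e2 : Complex.exp (-((r * s : ℝ) - d) * Complex.I)
        = Complex.exp (-(r * s * Complex.I)) * Complex.exp (d * Complex.I) := by
      rw [← Complex.exp_add]; congr 1; push_cast; ring
    simp only [Complex.cos, e1, e2]
    ring
  · exact (integrableOn_mul_cont hk (by fun_prop)).const_mul _
  · exact (integrableOn_mul_cont hk (by fun_prop)).const_mul _

lemma besselJ_continuousOn (μ : ℂ) : ContinuousOn (besselJ μ) (Ioi 0) := by
  have : ContinuousOn (fun x : ℝ => ((x / 2 : ℝ) : ℂ) ^ μ * besG μ ((x ^ 2 / 4 : ℝ) : ℂ)) (Ioi 0) := by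
    refine ContinuousOn.mul ?_ ?_
    · intro x hx
      apply ContinuousAt.continuousWithinAt
      have h1 : ContinuousAt (fun w : ℂ => w ^ μ) ((x / 2 : ℝ) : ℂ) := by
        apply continuousAt_cpow_const
        rw [Complex.ofReal_mem_slitPlane]
        exact half_pos hx
      exact ContinuousAt.comp (f := fun x : ℝ => ((x / 2 : ℝ) : ℂ)) h1
        (Complex.continuous_ofReal.comp (by fun_prop)).continuousAt
    · exact ((besG_continuous μ).comp (Complex.continuous_ofReal.comp (by fun_prop))).continuousOn
  exact this.congr fun x hx => besselJ_eq μ hx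

lemma kernel_tendsto {k : ℝ → ℂ} {δ : ℝ} (hδ : 0 < δ) (hk : IntegrableOn k (Ioo 0 1))
    (hv : ∀ s, 0 < s → s ≤ δ → k s = 0) (μ : ℂ) :
    Tendsto (fun r : ℝ => ∫ s in Ioo (0:ℝ) 1, k s * (((√(r * s) : ℝ) : ℂ) * besselJ μ (r * s)))
      atTop (𝓝 0) := by
  set d : ℂ := Real.pi / 2 * μ + Real.pi / 4 with hd
  set c : ℂ := ((√(2 / Real.pi) : ℝ) : ℂ) with hc
  set E : ℝ → ℂ := fun x => ((√x : ℝ) : ℂ) * besselJ μ x - c * Complex.cos (x - d) with hE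
  have hE0 : Tendsto E atTop (𝓝 0) := besAsy μ
  have hEc : ContinuousOn E (Ioi 0) := by
    refine ContinuousOn.sub (ContinuousOn.mul ?_ (besselJ_continuousOn μ)) ?_
    · exact (Complex.continuous_ofReal.comp Real.continuous_sqrt).continuousOn
    · exact Continuous.continuousOn (by fun_prop)
  have hm : ∀ r : ℝ, 0 < r → AEStronglyMeasurable (fun s => k s * E (r * s))
      (volume.restrict (Ioo 0 1)) := by
    intro r hr
    refine hk.aestronglyMeasurable.mul ?_
    refine ContinuousOn.aestronglyMeasurable ?_ measurableSet_Ioo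
    exact hEc.comp (by fun_prop) fun s hs => mul_pos hr hs.1
  have hbd : ∀ᶠ r : ℝ in atTop, ∀ᵐ s ∂(volume.restrict (Ioo (0:ℝ) 1)),
      ‖k s * E (r * s)‖ ≤ ‖k s‖ := by
    have h1 := (tendsto_zero_iff_norm_tendsto_zero.mp hE0).eventually_le_const one_pos
    obtain ⟨X, hX⟩ := eventually_atTop.mp h1
    filter_upwards [eventually_ge_atTop (X / δ), eventually_gt_atTop 0] with r hr hr0
    refine (ae_restrict_iff' measurableSet_Ioo).mpr (Eventually.of_forall fun s hs => ?_)
    by_cases h : s ≤ δ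
    · simp [hv s hs.1 h]
    · rw [norm_mul]
      refine mul_le_of_le_one_right (norm_nonneg _) (hX _ ?_)
      rw [div_le_iff₀ hδ] at hr
      have := not_le.mp h
      nlinarith
  have hA : Tendsto (fun r : ℝ => ∫ s in Ioo (0:ℝ) 1, k s * E (r * s)) atTop (𝓝 0) := by
    have := tendsto_integral_filter_of_dominated_convergence
      (μ := volume.restrict (Ioo (0:ℝ) 1)) (l := (atTop : Filter ℝ))
      (F := fun r s => k s * E (r * s)) (f := fun _ => 0) (fun s => ‖k s‖)
      (by filter_upwards [eventually_gt_atTop 0] with r hr using hm r hr) hbd hk.norm ?_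
    · simpa using this
    · refine (ae_restrict_iff' measurableSet_Ioo).mpr (Eventually.of_forall fun s hs => ?_)
      have := (hE0.comp (tendsto_id.atTop_mul_const hs.1)).const_mul (k s)
      simpa using this
  have hB := (riemann_lebesgue_cos hk d).const_mul c
  have hAB := hA.add hB
  simp only [mul_zero, add_zero] at hAB
  refine hAB.congr' ?_
  filter_upwards [hbd, eventually_gt_atTop 0] with r hr hr0
  have hi1 : Integrable (fun s => k s * E (r * s)) (volume.restrict (Ioo (0:ℝ) 1)) :=
    Integrable.mono' hk.norm (hm r hr0) hr
  have hi2 : Integrable (fun s : ℝ => c * (k s * Complex.cos ((r * s : ℝ) - d)))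
      (volume.restrict (Ioo (0:ℝ) 1)) :=
    (integrableOn_mul_cont hk (by fun_prop)).const_mul _
  rw [← integral_const_mul, ← integral_add hi1 hi2]
  refine setIntegral_congr_fun measurableSet_Ioo fun s hs => ?_
  simp only [hE]
  ring

lemma sq_kernel (ν : ℂ) {r s : ℝ} (hr : 0 < r) (hs : 0 < s) :
    ((r / 2 : ℝ) : ℂ) ^ ν * (((s ^ 2 : ℝ) : ℂ) ^ ν * besG ν (((r ^ 2 / 4 : ℝ) : ℂ) * ((s ^ 2 : ℝ) : ℂ)))
      = (s : ℂ) ^ ν * besselJ ν (r * s) := by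
  rw [besselJ_eq ν (mul_pos hr hs), sq s, Complex.ofReal_mul s s,
    Complex.mul_cpow_ofReal_nonneg hs.le hs.le,
    show r * s / 2 = r / 2 * s by ring, Complex.ofReal_mul (r / 2) s,
    Complex.mul_cpow_ofReal_nonneg (by positivity) hs.le,
    show (((r * s) ^ 2 / 4 : ℝ) : ℂ) = ((r ^ 2 / 4 : ℝ) : ℂ) * (s * s) by push_cast; ring]
  ring

noncomputable def remI (ν : ℂ) (g : ℝ → ℂ) (r : ℝ) : ℂ :=
  ((r / 2 : ℝ) : ℂ) ^ ν *
    ∫ t in Ioo (0:ℝ) 1, (t : ℂ) ^ ν * g t * besG ν (((r ^ 2 / 4 : ℝ) : ℂ) * t)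

lemma remI_base {g : ℝ → ℂ} {δ : ℝ} (hδ : 0 < δ) (hg : IntegrableOn g (Ioo 0 1))
    (hv : ∀ t, 0 < t → t ≤ δ → g t = 0) (ν : ℂ) :
    remI ν g =o[atTop] fun r : ℝ => r ^ (-(1 / 2 : ℝ)) := by
  set δ' := √δ with hδ'
  have hδ0 : 0 < δ' := Real.sqrt_pos.mpr hδ
  have hvs : ∀ s, 0 < s → s ≤ δ' → g (s ^ 2) = 0 := fun s h0 h1 =>
    hv _ (by positivity) (by
      have := Real.sq_sqrt hδ.le
      rw [← this]; exact pow_le_pow_left₀ h0.le h1 2)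
  set k : ℝ → ℂ := fun s => ((2 * s) • g (s ^ 2)) *
    (((max s δ' : ℝ) : ℂ) ^ ν * ((max s δ' : ℝ) : ℂ) ^ (-(1 / 2) : ℂ)) with hkdef
  have hk : IntegrableOn k (Ioo 0 1) := integrableOn_mul_cont (integrable_sq_sub g hg)
    ((maxpow_cont hδ0 ν).mul (maxpow_cont hδ0 _))
  have hkv : ∀ s, 0 < s → s ≤ δ' → k s = 0 := fun s h0 h1 => by simp [hkdef, hvs s h0 h1]
  have h := kernel_tendsto hδ0 hk hkv ν
  have hne : ∀ᶠ r : ℝ in atTop, r ^ (-(1 / 2 : ℝ)) = 0 → remI ν g r = 0 := by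
    filter_upwards [eventually_gt_atTop 0] with r hr h0
    exact absurd h0 (Real.rpow_pos_of_pos hr _).ne'
  rw [← Asymptotics.isLittleO_norm_left, Asymptotics.isLittleO_iff_tendsto'
    (by filter_upwards [hne] with r hr h0; rw [hr h0, norm_zero])]
  refine (tendsto_zero_iff_norm_tendsto_zero.mp h).congr' ?_
  filter_upwards [eventually_gt_atTop 0] with r hr
  have hkey : ∫ s in Ioo (0:ℝ) 1, k s * (((√(r * s) : ℝ) : ℂ) * besselJ ν (r * s))
      = ((√r : ℝ) : ℂ) * remI ν g r := by
    rw [remI, integral_sq_sub (fun t : ℝ => (t : ℂ) ^ ν * g t * besG ν (((r ^ 2 / 4 : ℝ) : ℂ) * t)),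
      ← integral_const_mul, ← integral_const_mul]
    refine setIntegral_congr_fun measurableSet_Ioo fun s hs => ?_
    by_cases hsd : s ≤ δ'
    · simp [hkdef, hvs s hs.1 hsd]
    · have hs0 : (s : ℂ) ≠ 0 := by exact_mod_cast hs.1.ne'
      have hss : (s : ℂ) ^ (-(1 / 2) : ℂ) * ((√s : ℝ) : ℂ) = 1 := by
        have : ((√s : ℝ) : ℂ) = (s : ℂ) ^ (1 / 2 : ℂ) := by
          rw [Real.sqrt_eq_rpow, Complex.ofReal_cpow hs.1.le]; norm_num
        rw [this, ← Complex.cpow_add _ _ hs0]; simp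
      simp only [hkdef, max_eq_left (not_le.mp hsd).le, Complex.real_smul]
      rw [Real.sqrt_mul hr.le, Complex.ofReal_mul (√r) (√s)]
      have := sq_kernel ν hr hs.1
      linear_combination (((2 * s : ℝ) : ℂ) * g (s ^ 2) * (s : ℂ) ^ ν * ((√r : ℝ) : ℂ) *
        besselJ ν (r * s)) * hss - (((2 * s : ℝ) : ℂ) * g (s ^ 2) * ((√r : ℝ) : ℂ)) * this
  rw [hkey, norm_mul, Complex.norm_real, Real.norm_of_nonneg (Real.sqrt_nonneg r),
    Real.rpow_neg hr.le, Real.sqrt_eq_rpow, div_inv_eq_mul, mul_comm]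

/-- Functions with `n` integrable derivatives on `(0,1)`, zero near `0`, vanishing at `1`. -/
def PG (δ : ℝ) : ℕ → (ℝ → ℂ) → Prop
  | 0, g => IntegrableOn g (Ioo 0 1) ∧ ∀ t, 0 < t → t ≤ δ → g t = 0
  | n + 1, g => (IntegrableOn g (Ioo 0 1) ∧ ∀ t, 0 < t → t ≤ δ → g t = 0) ∧
      ∃ g' : ℝ → ℂ, (∀ t ∈ Ioo (0:ℝ) 1, HasDerivAt g (g' t) t) ∧ Tendsto g (𝓝[<] 1) (𝓝 0) ∧
        PG δ n g'

def QG (δ : ℝ) : ℕ → (ℝ → ℂ) → Prop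
  | 0, g => IntegrableOn g (Ioo 0 1) ∧ ∀ t, 0 < t → t ≤ δ → g t = 0
  | n + 1, g => (IntegrableOn g (Ioo 0 1) ∧ ∀ t, 0 < t → t ≤ δ → g t = 0) ∧
      ∃ g' : ℝ → ℂ, (∀ t ∈ Ioo (0:ℝ) 1, HasDerivAt g (g' t) t) ∧ QG δ n g'

lemma PG.base {δ : ℝ} {n : ℕ} {g : ℝ → ℂ} (h : PG δ n g) :
    IntegrableOn g (Ioo 0 1) ∧ ∀ t, 0 < t → t ≤ δ → g t = 0 := by
  cases n with
  | zero => exact h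
  | succ n => exact h.1

lemma QG.base {δ : ℝ} {n : ℕ} {g : ℝ → ℂ} (h : QG δ n g) :
    IntegrableOn g (Ioo 0 1) ∧ ∀ t, 0 < t → t ≤ δ → g t = 0 := by
  cases n with
  | zero => exact h
  | succ n => exact h.1

lemma remI_PG {δ : ℝ} (hδ : 0 < δ) (n : ℕ) : ∀ (g : ℝ → ℂ) (ν : ℂ), PG δ n g →
    remI ν g =o[atTop] fun r : ℝ => r ^ (-((n : ℝ) + 1 / 2)) := by
  induction n with
  | zero =>
    intro g ν h
    simpa using remI_base hδ h.1 h.2 ν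
  | succ n ih =>
    intro g ν h
    obtain ⟨⟨hgi, hgv⟩, g', hd, ht, hP⟩ := h
    obtain ⟨hgi', hgv'⟩ := hP.base
    have hstep : ∀ᶠ r : ℝ in atTop, remI ν g r = -(2 / r : ℝ) * remI (ν + 1) g' r := by
      filter_upwards [eventually_gt_atTop 0] with r hr
      set z : ℂ := ((r ^ 2 / 4 : ℝ) : ℂ) with hz
      have hi1 := integrableOn_besG hδ hgi hgv ν ν z
      have hi2 := integrableOn_besG hδ hgi' hgv' (ν + 1) (ν + 1) z
      have hI := intervalIntegral.integral_eq_sub_of_hasDerivAt_of_tendsto (a := 0) (b := 1)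
        (f := fun t : ℝ => ((t : ℂ) ^ (ν + 1) * besG (ν + 1) (z * t)) * g t)
        (f' := fun t : ℝ => (t : ℂ) ^ ν * g t * besG ν (z * t) +
          (t : ℂ) ^ (ν + 1) * g' t * besG (ν + 1) (z * t)) (fa := 0) (fb := 0) zero_lt_one ?_ ?_ ?_ ?_
      · rw [intervalIntegral.integral_of_le zero_le_one, integral_Ioc_eq_integral_Ioo,
          integral_add hi1 hi2, sub_zero] at hI
        have hr2 : ((r / 2 : ℝ) : ℂ) ≠ 0 := by exact_mod_cast (half_pos hr).ne'
        have hr0 : (r : ℂ) ≠ 0 := by exact_mod_cast hr.ne'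
        rw [remI, remI, ← hz, eq_neg_of_add_eq_zero_left hI, Complex.cpow_add _ _ hr2, Complex.cpow_one]
        push_cast
        field_simp
      · intro t ht
        refine ((besG_hasDerivAt_pow ν z ht.1).mul (hd t ht)).congr_deriv ?_
        ring
      · rw [intervalIntegrable_iff_integrableOn_Ioo_of_le zero_le_one]
        exact hi1.add hi2
      · refine tendsto_const_nhds.congr' ?_
        filter_upwards [Ioo_mem_nhdsGT hδ] with t ht
        rw [hgv t ht.1 ht.2.le, mul_zero]
      · have hc := (besG_hasDerivAt_pow ν z one_pos).continuousAt.tendsto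
        have := (hc.mono_left (nhdsWithin_le_nhds (s := Iio 1))).mul ht
        simpa using this
    have h1 := ih g' (ν + 1) hP
    have h2 : (fun r : ℝ => (-(2 / r : ℝ) : ℂ)) =O[atTop] fun r : ℝ => r ^ (-1 : ℝ) := by
      refine Asymptotics.IsBigO.of_bound 2 ?_
      filter_upwards [eventually_gt_atTop 0] with r hr
      rw [norm_neg, Complex.norm_real, Real.rpow_neg_one, norm_div, norm_inv]
      simp [div_eq_mul_inv]
    have h3 := h2.mul_isLittleO h1
    refine h3.congr' ?_ ?_
    · filter_upwards [hstep] with r hr using hr.symm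
    · filter_upwards [eventually_gt_atTop 0] with r hr
      rw [← Real.rpow_add hr]; congr 1; push_cast; ring



lemma PG.add {δ : ℝ} {n : ℕ} : ∀ {f g : ℝ → ℂ}, PG δ n f → PG δ n g →
    PG δ n (fun t => f t + g t) := by
  induction n with
  | zero =>
    intro f g hf hg
    exact ⟨hf.1.add hg.1, fun t h0 h1 => by simp [hf.2 t h0 h1, hg.2 t h0 h1]⟩
  | succ n ih =>
    intro f g hf hg
    obtain ⟨⟨a1, a2⟩, f', a3, a4, a5⟩ := hf
    obtain ⟨⟨b1, b2⟩, g', b3, b4, b5⟩ := hg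
    refine ⟨⟨a1.add b1, fun t h0 h1 => by simp [a2 t h0 h1, b2 t h0 h1]⟩,
      fun t => f' t + g' t, fun t ht => (a3 t ht).add (b3 t ht), ?_, ih a5 b5⟩
    simpa using a4.add b4

lemma PG.const_mul {δ : ℝ} {n : ℕ} (c : ℂ) : ∀ {f : ℝ → ℂ}, PG δ n f →
    PG δ n (fun t => c * f t) := by
  induction n with
  | zero =>
    intro f hf
    exact ⟨hf.1.const_mul c, fun t h0 h1 => by simp [hf.2 t h0 h1]⟩
  | succ n ih =>
    intro f hf
    obtain ⟨⟨a1, a2⟩, f', a3, a4, a5⟩ := hf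
    refine ⟨⟨a1.const_mul c, fun t h0 h1 => by simp [a2 t h0 h1]⟩,
      fun t => c * f' t, fun t ht => (a3 t ht).const_mul c, ?_, ih a5⟩
    simpa using a4.const_mul c

lemma QG.pred {δ : ℝ} {n : ℕ} : ∀ {f : ℝ → ℂ}, QG δ (n + 1) f → QG δ n f := by
  induction n with
  | zero => intro f hf; exact hf.1
  | succ n ih =>
    intro f hf
    obtain ⟨a, f', b, c⟩ := hf
    exact ⟨a, f', b, ih c⟩

lemma one_sub_cpow_hasDerivAt (L : ℂ) {t : ℝ} (ht : t ∈ Ioo (0:ℝ) 1) :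
    HasDerivAt (fun t : ℝ => ((1 - t : ℝ) : ℂ) ^ L) (-L * ((1 - t : ℝ) : ℂ) ^ (L - 1)) t := by
  have h0 : 0 < 1 - t := by linarith [ht.2]
  have h1 : HasDerivAt (fun t : ℝ => ((1 - t : ℝ) : ℂ)) (-1) t := by
    have : HasDerivAt (fun t : ℝ => 1 - t) (-1) t := by
      simpa using (hasDerivAt_id t).const_sub 1
    simpa using this.ofReal_comp
  have h2 : HasDerivAt (fun w : ℂ => w ^ L) (L * ((1 - t : ℝ) : ℂ) ^ (L - 1)) ((1 - t : ℝ) : ℂ) := by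
    have := (hasDerivAt_id ((1 - t : ℝ) : ℂ)).cpow_const (c := L)
      (Complex.ofReal_mem_slitPlane.mpr h0)
    simpa using this
  exact (HasDerivAt.comp (h := fun t : ℝ => ((1 - t : ℝ) : ℂ)) t h2 h1).congr_deriv (by ring)

lemma one_sub_cpow_mul_integrable {L : ℂ} (hL : 0 ≤ L.re) {f : ℝ → ℂ}
    (hf : IntegrableOn f (Ioo 0 1)) :
    IntegrableOn (fun t : ℝ => ((1 - t : ℝ) : ℂ) ^ L * f t) (Ioo 0 1) := by
  refine Integrable.mono' hf.norm ?_ ?_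
  · refine AEStronglyMeasurable.mul ?_ hf.aestronglyMeasurable
    refine ContinuousOn.aestronglyMeasurable ?_ measurableSet_Ioo
    exact fun t ht => (one_sub_cpow_hasDerivAt L ht).continuousAt.continuousWithinAt
  · refine (ae_restrict_iff' measurableSet_Ioo).mpr (Eventually.of_forall fun t ht => ?_)
    rw [norm_mul, Complex.norm_cpow_eq_rpow_re_of_pos (by linarith [ht.2])]
    refine mul_le_of_le_one_left (norm_nonneg _) ?_
    exact Real.rpow_le_one (by linarith [ht.2]) (by linarith [ht.1]) hL

lemma QG.bdd {δ : ℝ} (hδ : 0 < δ) (hδ1 : δ < 1) {n : ℕ} {f : ℝ → ℂ} (h : QG δ (n + 1) f) :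
    ∃ C, ∀ t ∈ Ioo (0:ℝ) 1, ‖f t‖ ≤ C := by
  obtain ⟨⟨hi, hv⟩, f', hd, hQ⟩ := h
  have hi' := hQ.base.1
  refine ⟨∫ t in Ioo (0:ℝ) 1, ‖f' t‖, fun t ht => ?_⟩
  by_cases htd : t ≤ δ
  · rw [hv t ht.1 htd, norm_zero]
    exact integral_nonneg fun _ => norm_nonneg _
  · have htd' := (not_le.mp htd).le
    have hsub : Ioc δ t ⊆ Ioo (0:ℝ) 1 := fun x hx => ⟨hδ.trans hx.1, hx.2.trans_lt ht.2⟩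
    have hII : IntervalIntegrable f' volume δ t := by
      rw [intervalIntegrable_iff_integrableOn_Ioc_of_le htd']
      exact hi'.mono_set hsub
    have hI := intervalIntegral.integral_eq_sub_of_hasDerivAt (a := δ) (b := t) (f := f) (f' := f')
      (fun x hx => by
        rw [uIcc_of_le htd'] at hx
        exact hd x ⟨hδ.trans_le hx.1, hx.2.trans_lt ht.2⟩) hII
    rw [hv δ hδ le_rfl, sub_zero] at hI
    rw [← hI, intervalIntegral.integral_of_le htd']
    refine (norm_integral_le_integral_norm _).trans ?_
    exact setIntegral_mono_set hi'.norm (Eventually.of_forall fun _ => norm_nonneg _)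
      (LE.le.eventuallyLE hsub)

lemma PG_of_QG {δ : ℝ} (hδ : 0 < δ) (hδ1 : δ < 1) {n : ℕ} : ∀ {f : ℝ → ℂ} {L : ℂ}, QG δ n f →
    (n : ℝ) ≤ L.re → PG δ n (fun t => ((1 - t : ℝ) : ℂ) ^ L * f t) := by
  induction n with
  | zero =>
    intro f L hf hL
    exact ⟨one_sub_cpow_mul_integrable (by simpa using hL) hf.1,
      fun t h0 h1 => by simp [hf.2 t h0 h1]⟩
  | succ n ih =>
    intro f L hf hL
    push_cast at hL
    have hn : (0:ℝ) ≤ n := Nat.cast_nonneg n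
    obtain ⟨C, hC⟩ := hf.bdd hδ hδ1
    have hf1 := hf.pred
    obtain ⟨⟨hi, hv⟩, f', hd, hQ⟩ := hf
    refine ⟨⟨one_sub_cpow_mul_integrable (by linarith) hi, fun t h0 h1 => by simp [hv t h0 h1]⟩,
      fun t => ((1 - t : ℝ) : ℂ) ^ L * f' t + (-L) * (((1 - t : ℝ) : ℂ) ^ (L - 1) * f t),
      fun t ht => ?_, ?_, ?_⟩
    · exact ((one_sub_cpow_hasDerivAt L ht).mul (hd t ht)).congr_deriv (by ring)
    · have hlim : Tendsto (fun t : ℝ => (1 - t) ^ L.re * C) (𝓝[<] 1) (𝓝 0) := by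
        have : ContinuousAt (fun t : ℝ => (1 - t) ^ L.re * C) 1 := by
          refine ContinuousAt.mul ?_ continuousAt_const
          exact ContinuousAt.rpow_const (by fun_prop) (Or.inr (by linarith))
        have h := this.tendsto.mono_left (nhdsWithin_le_nhds (s := Iio 1))
        simpa [Real.zero_rpow (show L.re ≠ 0 by linarith)] using h
      refine squeeze_zero_norm' ?_ hlim
      filter_upwards [Ioo_mem_nhdsLT (zero_lt_one (α := ℝ))] with t ht
      rw [norm_mul, Complex.norm_cpow_eq_rpow_re_of_pos (by linarith [ht.2])]
      exact mul_le_mul_of_nonneg_left (hC t ht) (Real.rpow_nonneg (by linarith [ht.2]) _)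
    · refine (ih hQ (by linarith)).add ((ih hf1 ?_).const_mul (-L))
      simp only [Complex.sub_re, Complex.one_re]
      linarith

lemma QG_cutoff {N : ℕ} {ε : ℝ} (hε : 0 < ε) (hε' : ε < 1 / 3)
    {ψ : ℝ → ℂ} (hψ : ContDiffOn ℝ (⊤ : ℕ∞) ψ (Set.Ioo 0 1))
    (hψint : ∀ k : ℕ, k ≤ N →
      IntegrableOn (iteratedDerivWithin k ψ (Set.Ioo 0 1)) (Set.Ioo (1 - 2 * ε) 1))
    {χ₁ : ℝ → ℝ} (hχ : ContDiffOn ℝ (⊤ : ℕ∞) χ₁ (Set.Ioo 0 1))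
    (hχzero : ∀ t : ℝ, 0 < t → t ≤ 1 - 2 * ε → χ₁ t = 0)
    (hχone : ∀ t : ℝ, 1 - ε ≤ t → t < 1 → χ₁ t = 1) :
    QG ((1 - 2 * ε) / 2) N (fun t => (χ₁ t : ℂ) * ψ t) := by
  set f : ℝ → ℂ := fun t => (χ₁ t : ℂ) * ψ t with hf
  have hfs : ContDiffOn ℝ (⊤ : ℕ∞) f (Ioo 0 1) :=
    (Complex.ofRealCLM.contDiff.comp_contDiffOn hχ).mul hψ
  have hU : UniqueDiffOn ℝ (Ioo (0:ℝ) 1) := isOpen_Ioo.uniqueDiffOn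
  have hlt : ∀ k : ℕ, ((k : ℕ∞) : WithTop ℕ∞) < ((⊤ : ℕ∞) : WithTop ℕ∞) := fun k => by
    exact_mod_cast ENat.natCast_lt_top k
  have hder : ∀ k : ℕ, ∀ t ∈ Ioo (0:ℝ) 1, HasDerivAt (iteratedDerivWithin k f (Ioo 0 1))
      (iteratedDerivWithin (k + 1) f (Ioo 0 1) t) t := by
    intro k t ht
    have h1 := (hfs.differentiableOn_iteratedDerivWithin (hlt k) hU) t ht
    have h2 := h1.hasDerivWithinAt.hasDerivAt (isOpen_Ioo.mem_nhds ht)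
    rwa [← iteratedDerivWithin_succ] at h2
  have hzero : ∀ k : ℕ, ∀ t, 0 < t → t ≤ (1 - 2 * ε) / 2 →
      iteratedDerivWithin k f (Ioo 0 1) t = 0 := by
    intro k t h0 h1
    have he : f =ᶠ[𝓝[Ioo 0 1] t] fun _ => 0 := by
      refine Filter.Eventually.filter_mono nhdsWithin_le_nhds ?_
      filter_upwards [Ioo_mem_nhds h0 (show t < 1 - 2 * ε by linarith)] with s hs
      simp [hf, hχzero s hs.1 hs.2.le]
    rw [he.iteratedDerivWithin_eq (he.eq_of_nhdsWithin ⟨h0, by linarith⟩)]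
    simp
  have hint : ∀ k : ℕ, k ≤ N → IntegrableOn (iteratedDerivWithin k f (Ioo 0 1)) (Ioo 0 1) := by
    intro k hk
    have hsub : Ioo (0:ℝ) 1 ⊆ (Ioc 0 ((1 - 2 * ε) / 2) ∪ Icc ((1 - 2 * ε) / 2) (1 - ε)) ∪
        Ioo (1 - ε) 1 := by
      intro t ht
      by_cases h1 : t ≤ (1 - 2 * ε) / 2
      · exact Or.inl (Or.inl ⟨ht.1, h1⟩)
      · by_cases h2 : t ≤ 1 - ε
        · exact Or.inl (Or.inr ⟨(not_le.mp h1).le, h2⟩)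
        · exact Or.inr ⟨not_le.mp h2, ht.2⟩
    refine IntegrableOn.mono_set ((IntegrableOn.union ?_ ?_).union ?_) hsub
    · refine (integrableOn_zero (s := Ioc 0 ((1 - 2 * ε) / 2))).congr_fun (fun t ht => ?_)
        measurableSet_Ioc
      exact (hzero k t ht.1 ht.2).symm
    · refine ContinuousOn.integrableOn_compact isCompact_Icc ?_
      refine (hfs.continuousOn_iteratedDerivWithin (hlt k).le hU).mono fun t ht => ?_
      exact ⟨by linarith [ht.1], by linarith [ht.2]⟩
    · refine ((hψint k hk).mono_set (Ioo_subset_Ioo_left (by linarith))).congr_fun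
        (fun t ht => ?_) measurableSet_Ioo
      have he : f =ᶠ[𝓝[Ioo 0 1] t] ψ := by
        refine Filter.Eventually.filter_mono nhdsWithin_le_nhds ?_
        filter_upwards [Ioo_mem_nhds ht.1 ht.2] with s hs
        simp [hf, hχone s hs.1.le hs.2]
      rw [he.iteratedDerivWithin_eq (he.eq_of_nhdsWithin ⟨by linarith [ht.1], ht.2⟩)]
  have hall : ∀ n k : ℕ, n + k ≤ N → QG ((1 - 2 * ε) / 2) n (iteratedDerivWithin k f (Ioo 0 1)) := by
    intro n
    induction n with
    | zero => intro k hk; exact ⟨hint k (by omega), hzero k⟩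
    | succ n ih =>
      intro k hk
      exact ⟨⟨hint k (by omega), hzero k⟩, _, hder k, ih (k + 1) (by omega)⟩
  have := hall N 0 (by omega)
  rwa [iteratedDerivWithin_zero] at this


/-- Leading term of the expansion attached to the exponent `l`. -/
noncomputable def leadT (ν l c : ℂ) (r : ℝ) : ℂ :=
  c * (2 : ℂ) ^ (l + 1 / 2) / ((Real.sqrt Real.pi : ℝ) : ℂ) *
    Complex.Gamma (l + 1) * (r : ℂ) ^ (-(l + 3 / 2)) *
    Complex.cos ((r : ℂ) - (Real.pi : ℂ) / 2 * (ν + l + 1) - (Real.pi : ℂ) / 4)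

/-- Exact Sonine term attached to the exponent `l`. -/
noncomputable def exactT (ν l c : ℂ) (r : ℝ) : ℂ :=
  1 / 2 * ((r / 2 : ℝ) : ℂ) ^ ν *
    (c * (Complex.Gamma (l + 1) * besG (ν + l + 1) ((r ^ 2 / 4 : ℝ) : ℂ)))

lemma cpow_isBigO (l : ℂ) :
    (fun r : ℝ => (r : ℂ) ^ (-(l + 3 / 2))) =O[atTop] fun r : ℝ => r ^ (-(l.re + 3 / 2)) := by
  refine Asymptotics.IsBigO.of_bound 1 ?_
  filter_upwards [eventually_gt_atTop 0] with r hr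
  rw [Complex.norm_cpow_eq_rpow_re_of_pos hr, one_mul, Real.norm_of_nonneg (Real.rpow_nonneg hr.le _)]
  apply le_of_eq
  congr 1
  norm_num

lemma leadT_isBigO (ν l c : ℂ) :
    leadT ν l c =O[atTop] fun r : ℝ => r ^ (-(l.re + 3 / 2)) := by
  obtain ⟨C, hC⟩ := cos_bdd ((Real.pi : ℂ) / 2 * (ν + l + 1) + (Real.pi : ℂ) / 4)
  have h1 : (fun r : ℝ => Complex.cos ((r : ℂ) - (Real.pi : ℂ) / 2 * (ν + l + 1) - (Real.pi : ℂ) / 4))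
      =O[atTop] fun _ : ℝ => (1 : ℝ) := by
    refine Asymptotics.IsBigO.of_bound C (Eventually.of_forall fun r => ?_)
    rw [sub_sub]
    simpa using hC r
  have h2 := ((cpow_isBigO l).const_mul_left
    (c * (2 : ℂ) ^ (l + 1 / 2) / ((Real.sqrt Real.pi : ℝ) : ℂ) * Complex.Gamma (l + 1))).mul h1
  simp only [mul_one] at h2
  exact h2

lemma exactT_sub_leadT (ν l c : ℂ) :
    (fun r => exactT ν l c r - leadT ν l c r) =o[atTop] fun r : ℝ => r ^ (-(l.re + 3 / 2)) := by
  have h0 : Tendsto (fun x : ℝ => ((√x : ℝ) : ℂ) * besselJ (ν + l + 1) x -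
      ((√(2 / Real.pi) : ℝ) : ℂ) *
        Complex.cos (x - (Real.pi / 2 * (ν + l + 1) + Real.pi / 4))) atTop (𝓝 0) :=
    besAsy (ν + l + 1)
  have h1 := (Asymptotics.isLittleO_one_iff ℝ).mpr h0
  have h2 := ((cpow_isBigO l).const_mul_left (c * Complex.Gamma (l + 1) * (2 : ℂ) ^ l)).mul_isLittleO h1
  simp only [mul_one] at h2
  refine h2.congr' ?_ EventuallyEq.rfl
  filter_upwards [eventually_gt_atTop 0] with r hr
  have hrc : (r : ℂ) ≠ 0 := by exact_mod_cast hr.ne'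
  have hr2 : ((r / 2 : ℝ) : ℂ) ≠ 0 := by exact_mod_cast (half_pos hr).ne'
  have e1 : ((r / 2 : ℝ) : ℂ) ^ ν * besG (ν + l + 1) ((r ^ 2 / 4 : ℝ) : ℂ)
      = ((r / 2 : ℝ) : ℂ) ^ (-(l + 1)) * besselJ (ν + l + 1) r := by
    rw [besselJ_eq _ hr, ← mul_assoc, ← Complex.cpow_add _ _ hr2]
    congr 2
    ring
  have e2 : ((r / 2 : ℝ) : ℂ) ^ (-(l + 1)) = (r : ℂ) ^ (-(l + 3 / 2)) * ((√r : ℝ) : ℂ) * (2 * 2 ^ l) := by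
    have hs : ((√r : ℝ) : ℂ) = (r : ℂ) ^ (1 / 2 : ℂ) := by
      rw [Real.sqrt_eq_rpow, Complex.ofReal_cpow hr.le]; norm_num
    have h2 : ((2⁻¹ : ℝ) : ℂ) ^ (-(l + 1)) = 2 * 2 ^ l := by
      rw [Complex.ofReal_inv, Complex.inv_cpow _ _ (by
        rw [Complex.arg_ofReal_of_nonneg (by norm_num)]; exact Real.pi_pos.ne),
        Complex.cpow_neg, inv_inv, Complex.ofReal_ofNat, Complex.cpow_add _ _ two_ne_zero,
        Complex.cpow_one, mul_comm]
    rw [hs, ← Complex.cpow_add _ _ hrc, div_eq_mul_inv, Complex.ofReal_mul,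
      Complex.mul_cpow_ofReal_nonneg hr.le (by norm_num), h2]
    congr 2
    ring
  have e3 : (2 : ℂ) ^ (l + 1 / 2) / ((√Real.pi : ℝ) : ℂ) = 2 ^ l * ((√(2 / Real.pi) : ℝ) : ℂ) := by
    have hs : ((√2 : ℝ) : ℂ) = (2 : ℂ) ^ (1 / 2 : ℂ) := by
      rw [Real.sqrt_eq_rpow, Complex.ofReal_cpow (by norm_num)]; norm_num
    rw [Complex.cpow_add _ _ two_ne_zero, ← hs, Real.sqrt_div (by norm_num)]
    push_cast
    ring
  simp only [exactT, leadT]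
  rw [mul_div_assoc, e3, sub_sub]
  rw [e2] at e1
  linear_combination -(1 / 2 * c * Complex.Gamma (l + 1)) * e1

lemma rpow_isBigO {p q : ℝ} (h : p ≤ q) :
    (fun r : ℝ => r ^ (-q)) =O[atTop] fun r : ℝ => r ^ (-p) := by
  refine Asymptotics.IsBigO.of_bound 1 ?_
  filter_upwards [eventually_ge_atTop 1] with r hr
  have h0 : 0 ≤ r := by linarith
  rw [one_mul, Real.norm_of_nonneg (Real.rpow_nonneg h0 _), Real.norm_of_nonneg (Real.rpow_nonneg h0 _)]
  exact Real.rpow_le_rpow_of_exponent_le hr (by linarith)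

lemma rpow_isLittleO {p q : ℝ} (h : p < q) :
    (fun r : ℝ => r ^ (-q)) =o[atTop] fun r : ℝ => r ^ (-p) := by
  rw [Asymptotics.isLittleO_iff_tendsto' (by
    filter_upwards [eventually_gt_atTop 0] with r hr h0
    exact absurd h0 (Real.rpow_pos_of_pos hr _).ne')]
  refine (tendsto_rpow_neg_atTop (sub_pos.mpr h)).congr' ?_
  filter_upwards [eventually_gt_atTop 0] with r hr
  rw [← Real.rpow_sub hr]
  congr 1
  ring

lemma hankel_split (m : ℕ) (ν : ℂ) (lam a : Fin (m + 1) → ℂ) (hν : -1 < ν.re)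
    (hlam : ∀ k, -1 < (lam k).re) {δ : ℝ} (hδ : 0 < δ) {g : ℝ → ℂ}
    (hgi : IntegrableOn g (Ioo 0 1)) (hgv : ∀ t, 0 < t → t ≤ δ → g t = 0) {r : ℝ} (hr : 0 < r) :
    (∫ s in (0:ℝ)..1, (s : ℂ) ^ (ν + 1) *
      ((∑ k : Fin (m + 1), a k * ((1 - s ^ 2 : ℝ) : ℂ) ^ (lam k)) + g (s ^ 2)) *
        besselJ ν (r * s)) = (∑ k, exactT ν (lam k) (a k) r) + 1 / 2 * remI ν g r := by
  set z : ℂ := ((r ^ 2 / 4 : ℝ) : ℂ) with hz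
  have h1 : (∫ s in (0:ℝ)..1, (s : ℂ) ^ (ν + 1) *
      ((∑ k : Fin (m + 1), a k * ((1 - s ^ 2 : ℝ) : ℂ) ^ (lam k)) + g (s ^ 2)) *
        besselJ ν (r * s)) = 1 / 2 * ((r / 2 : ℝ) : ℂ) ^ ν * ∫ t in Ioo (0:ℝ) 1,
        ((∑ k : Fin (m + 1), a k * ((t : ℂ) ^ ν * ((1 - t : ℝ) : ℂ) ^ (lam k) * besG ν (z * t))) +
          (t : ℂ) ^ ν * g t * besG ν (z * t)) := by
    rw [integral_sq_sub, intervalIntegral.integral_of_le zero_le_one, integral_Ioc_eq_integral_Ioo,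
      ← integral_const_mul]
    refine setIntegral_congr_fun measurableSet_Ioo fun s hs => ?_
    have hs0 : (s : ℂ) ≠ 0 := by exact_mod_cast hs.1.ne'
    have hk := sq_kernel ν hr hs.1
    have hS : (∑ k : Fin (m + 1), a k * (((s ^ 2 : ℝ) : ℂ) ^ ν * ((1 - s ^ 2 : ℝ) : ℂ) ^ (lam k) *
        besG ν (z * ((s ^ 2 : ℝ) : ℂ)))) = (∑ k : Fin (m + 1), a k * ((1 - s ^ 2 : ℝ) : ℂ) ^ (lam k)) *
        (((s ^ 2 : ℝ) : ℂ) ^ ν * besG ν (z * ((s ^ 2 : ℝ) : ℂ))) := by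
      rw [Finset.sum_mul]
      exact Finset.sum_congr rfl fun k _ => by ring
    simp only [Complex.real_smul]
    rw [hS, Complex.cpow_add _ _ hs0, Complex.cpow_one, Complex.ofReal_mul 2 s, Complex.ofReal_ofNat]
    linear_combination -((s : ℂ) * ((∑ k : Fin (m + 1), a k * ((1 - s ^ 2 : ℝ) : ℂ) ^ (lam k)) +
      g (s ^ 2))) * hk
  have hi : ∀ k : Fin (m + 1), Integrable (fun t : ℝ => a k * ((t : ℂ) ^ ν *
      ((1 - t : ℝ) : ℂ) ^ (lam k) * besG ν (z * t))) (volume.restrict (Ioo (0:ℝ) 1)) := fun k =>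
    (beta_besG_integrableOn hν (hlam k) z).const_mul _
  rw [h1, integral_add (integrable_finsetSum _ fun k _ => hi k) (integrableOn_besG hδ hgi hgv ν ν z),
    integral_finsetSum _ fun k _ => hi k, mul_add, Finset.mul_sum]
  congr 1
  · refine Finset.sum_congr rfl fun k _ => ?_
    rw [integral_const_mul, sonine hν (hlam k), exactT]
  · rw [remI]; ring


/-- Asymptotic expansion of a finite Hankel transform with singularities at `s = 1`:
for `φ̃(t) = Σ_{k=0}^m a_k (1-t)^{λ_k} + χ₁(t) (1-t)^Λ ψ(t)`,
`∫₀¹ s^{ν+1} φ̃(s²) J_ν(rs) ds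
  = a₀ 2^{λ₀+1/2} π^{-1/2} Γ(λ₀+1) r^{-(λ₀+3/2)} cos(r - (π/2)(ν+λ₀+1) - π/4)
    + o(r^{-Re(λ₀+3/2)})` as `r → ∞`. -/
theorem finite_hankel_boundary_expansion (N : ℕ) (m : ℕ)
    (ν Λ : ℂ) (lam a : Fin (m + 1) → ℂ)
    (hν : -1 < ν.re) (hlam0 : -1 < (lam 0).re)
    (hmono : ∀ i j : Fin (m + 1), i < j → (lam i).re < (lam j).re)
    (hlamΛ : (lam (Fin.last m)).re < Λ.re)
    (hNΛ : (N : ℝ) ≤ Λ.re) (hlam0N : (lam 0).re ≤ (N : ℝ) - 1)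
    (ha0 : a 0 ≠ 0)
    (ε : ℝ) (hε : 0 < ε) (hε' : ε < 1 / 3)
    (ψ : ℝ → ℂ) (hψ : ContDiffOn ℝ (⊤ : ℕ∞) ψ (Set.Ioo 0 1))
    (hψint : ∀ k : ℕ, k ≤ N →
      IntegrableOn (iteratedDerivWithin k ψ (Set.Ioo 0 1)) (Set.Ioo (1 - 2 * ε) 1))
    (χ₁ : ℝ → ℝ) (hχ : ContDiffOn ℝ (⊤ : ℕ∞) χ₁ (Set.Ioo 0 1))
    (hχzero : ∀ t : ℝ, 0 < t → t ≤ 1 - 2 * ε → χ₁ t = 0)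
    (hχone : ∀ t : ℝ, 1 - ε ≤ t → t < 1 → χ₁ t = 1) :
    (fun r : ℝ =>
        (∫ s in (0:ℝ)..1, (s : ℂ) ^ (ν + 1) *
            ((∑ k : Fin (m + 1), a k * ((1 - s ^ 2 : ℝ) : ℂ) ^ (lam k)) +
              (χ₁ (s ^ 2) : ℂ) * ((1 - s ^ 2 : ℝ) : ℂ) ^ Λ * ψ (s ^ 2)) *
            besselJ ν (r * s)) -
          a 0 * (2 : ℂ) ^ (lam 0 + 1 / 2) / ((Real.sqrt Real.pi : ℝ) : ℂ) *
            Complex.Gamma (lam 0 + 1) * (r : ℂ) ^ (-(lam 0 + 3 / 2)) *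
            Complex.cos ((r : ℂ) - (Real.pi : ℂ) / 2 * (ν + lam 0 + 1) - (Real.pi : ℂ) / 4))
      =o[atTop] fun r : ℝ => r ^ (-((lam 0).re + 3 / 2)) := by
  have hm0 : ∀ k : Fin (m + 1), k ≠ 0 → (lam 0).re < (lam k).re := fun k hk =>
    hmono 0 k (Fin.pos_iff_ne_zero.mpr hk)
  have hlam : ∀ k, -1 < (lam k).re := fun k => by
    by_cases hk : k = 0
    · rw [hk]; exact hlam0
    · exact hlam0.trans (hm0 k hk)
  have hδ : 0 < (1 - 2 * ε) / 2 := by linarith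
  have hδ1 : (1 - 2 * ε) / 2 < 1 := by linarith
  have hP := PG_of_QG hδ hδ1 (QG_cutoff hε hε' hψ hψint hχ hχzero hχone) hNΛ
  set g : ℝ → ℂ := fun t => ((1 - t : ℝ) : ℂ) ^ Λ * ((χ₁ t : ℂ) * ψ t) with hg
  have hR := ((remI_PG hδ N g ν hP).trans_isBigO
    (rpow_isBigO (show (lam 0).re + 3 / 2 ≤ (N : ℝ) + 1 / 2 by linarith))).const_mul_left (1 / 2 : ℂ)
  have h0 := exactT_sub_leadT ν (lam 0) (a 0)
  have hS : (fun r : ℝ => ∑ k : Fin m, exactT ν (lam k.succ) (a k.succ) r) =o[atTop]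
      fun r : ℝ => r ^ (-((lam 0).re + 3 / 2)) := by
    refine Asymptotics.IsLittleO.fun_sum (ι := Fin m) (s := Finset.univ)
      (A := fun k r => exactT ν (lam k.succ) (a k.succ) r) ?_
    intro k _
    have hk := hm0 k.succ (Fin.succ_ne_zero k)
    have h1 := (exactT_sub_leadT ν (lam k.succ) (a k.succ)).isBigO.add
      (leadT_isBigO ν (lam k.succ) (a k.succ))
    simp only [sub_add_cancel] at h1
    exact h1.trans_isLittleO (rpow_isLittleO (by linarith))
  have hT := (h0.add hS).add hR
  refine hT.congr' ?_ EventuallyEq.rfl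
  filter_upwards [eventually_gt_atTop 0] with r hr
  have hsp := hankel_split m ν lam a hν hlam hδ hP.base.1 hP.base.2 hr
  have hcong : ∀ s : ℝ, (χ₁ (s ^ 2) : ℂ) * ((1 - s ^ 2 : ℝ) : ℂ) ^ Λ * ψ (s ^ 2) = g (s ^ 2) :=
    fun s => by simp only [hg]; ring
  simp only [hcong]
  rw [hsp, Fin.sum_univ_succ]
  simp only [leadT]
  ring
end

section
/- Let r > 0 and let ν, α ∈ ℂ with Re ν > −1 and Re α > −1. Then ∫₀¹ s^{ν+1} (1 − s²)^α J_ν(rs) ds = 2^α Γ(α + 1) r^{−(α+1)} J_{ν+α+1}(r). -/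
open MeasureTheory Filter Set

lemma sonine_base (a b : ℂ) (ha : 0 < a.re) (hb : 0 < b.re) :
    IntegrableOn (fun s : ℝ => (s : ℂ) ^ (2 * a - 1) * ((1 - s ^ 2 : ℝ) : ℂ) ^ (b - 1)) (Ioo 0 1) ∧
    ∫ s in Ioo (0:ℝ) 1, (s : ℂ) ^ (2 * a - 1) * ((1 - s ^ 2 : ℝ) : ℂ) ^ (b - 1)
      = Complex.betaIntegral a b / 2 := by
  set f : ℝ → ℂ := fun u => (u : ℂ) ^ (a - 1) * (1 - (u : ℂ)) ^ (b - 1) with hf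
  set h : ℝ → ℂ := fun s : ℝ => (s : ℂ) ^ (2 * a - 1) * ((1 - s ^ 2 : ℝ) : ℂ) ^ (b - 1) with hh
  have hconv : IntegrableOn f (Ioo 0 1) := by
    have := Complex.betaIntegral_convergent ha hb
    rw [intervalIntegrable_iff_integrableOn_Ioc_of_le zero_le_one] at this
    exact this.mono_set Ioo_subset_Ioc_self
  have key : ∀ x ∈ Ioi (0:ℝ), (|(2:ℝ)| * x ^ ((2:ℝ) - 1)) • (Ioo (0:ℝ) 1).indicator f (x ^ (2:ℝ))
      = (Ioo (0:ℝ) 1).indicator (fun s => 2 * h s) x := by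
    intro x hx
    have hx0 : 0 < x := hx
    by_cases hx1 : x < 1
    · have h1 : x ^ (2:ℝ) ∈ Ioo (0:ℝ) 1 := by
        rw [Real.rpow_two]; exact ⟨by positivity, by nlinarith⟩
      rw [indicator_of_mem h1, indicator_of_mem (show x ∈ Ioo (0:ℝ) 1 from ⟨hx0, hx1⟩)]
      have hxc : (x : ℂ) ≠ 0 := by exact_mod_cast hx0.ne'
      have e1 : ((x ^ 2 : ℝ) : ℂ) ^ (a - 1) = (x : ℂ) ^ (2 * a - 2) := by
        rw [pow_two, Complex.ofReal_mul, Complex.mul_cpow_ofReal_nonneg hx0.le hx0.le,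
          ← Complex.cpow_add _ _ hxc]
        congr 1; ring
      have e2 : (x : ℂ) ^ (2 * a - 1) = (x : ℂ) ^ (2 * a - 2) * x := by
        rw [show 2 * a - 1 = (2 * a - 2) + 1 by ring, Complex.cpow_add _ _ hxc, Complex.cpow_one]
      simp only [hf, hh]
      rw [Real.rpow_two, e1, e2]
      norm_num
      ring
    · have h1 : x ^ (2:ℝ) ∉ Ioo (0:ℝ) 1 := by
        rw [Real.rpow_two]; rintro ⟨_, h⟩; nlinarith
      rw [indicator_of_notMem h1, indicator_of_notMem (fun h => hx1 h.2), smul_zero]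
  have hsub : Ioi (0:ℝ) ∩ Ioo 0 1 = Ioo 0 1 := by
    ext x; simp only [mem_inter_iff, mem_Ioi, mem_Ioo]; tauto
  constructor
  · have h1 : IntegrableOn ((Ioo (0:ℝ) 1).indicator f) (Ioi 0) := by
      exact (hconv.integrable_indicator measurableSet_Ioo).integrableOn
    rw [← integrableOn_Ioi_comp_rpow_iff _ (two_ne_zero (α := ℝ)),
      integrableOn_congr_fun key measurableSet_Ioi] at h1
    rw [IntegrableOn, integrable_indicator_iff measurableSet_Ioo, IntegrableOn,
      Measure.restrict_restrict measurableSet_Ioo, inter_comm, hsub] at h1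
    have := h1.const_mul (1/2)
    refine this.congr (ae_of_all _ fun x => ?_)
    simp only []
    ring
  · have h1 := integral_comp_rpow_Ioi ((Ioo (0:ℝ) 1).indicator f) (two_ne_zero (α := ℝ))
    rw [setIntegral_congr_fun measurableSet_Ioi key, setIntegral_indicator measurableSet_Ioo,
      setIntegral_indicator measurableSet_Ioo, hsub, integral_const_mul] at h1
    rw [Complex.betaIntegral, intervalIntegral.integral_of_le zero_le_one,
      integral_Ioc_eq_integral_Ioo, ← h1]
    ring

lemma sonine_gamma_bound (ν : ℂ) (hν : -1 < ν.re) :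
    ∃ C : ℝ, ∀ k : ℕ, ‖Complex.Gamma (ν + k + 1)‖⁻¹ ≤ C := by
  have step : ∀ k : ℕ, ‖Complex.Gamma (ν + (k+1:ℕ) + 1)‖⁻¹ ≤ ‖Complex.Gamma (ν + (0+1:ℕ) + 1)‖⁻¹ := by
    intro k
    induction k with
    | zero => simp
    | succ k ih =>
      refine le_trans ?_ ih
      set z := ν + (k+1:ℕ) + 1 with hz
      have hre : 1 ≤ z.re := by
        have : z.re = ν.re + (k + 1) + 1 := by simp [hz]
        have hk : (0:ℝ) ≤ k := k.cast_nonneg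
        linarith
      have hz0 : z ≠ 0 := by
        intro h; rw [h] at hre; norm_num at hre
      have e : ν + ((k+1+1:ℕ):ℂ) + 1 = z + 1 := by rw [hz]; push_cast; ring
      rw [e, Complex.Gamma_add_one _ hz0, norm_mul]
      have hg : 0 < ‖Complex.Gamma z‖ := norm_pos_iff.2 (Complex.Gamma_ne_zero_of_re_pos (by linarith))
      apply inv_anti₀ hg
      have : 1 ≤ ‖z‖ := hre.trans (Complex.re_le_norm z)
      nlinarith
  refine ⟨max ‖Complex.Gamma (ν + (0:ℕ) + 1)‖⁻¹ ‖Complex.Gamma (ν + (0+1:ℕ) + 1)‖⁻¹, fun k => ?_⟩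
  cases k with
  | zero => exact le_max_left _ _
  | succ k => exact (step k).trans (le_max_right _ _)

lemma sonine_coeff_summable (r : ℝ) (hr : 0 < r) (ν : ℂ) (hν : -1 < ν.re) :
    Summable fun k : ℕ => ‖((-1) ^ k / ((Nat.factorial k : ℂ) * Complex.Gamma (ν + k + 1))) *
      ((r / 2 : ℂ) ^ (2 * (k : ℂ) + ν))‖ := by
  obtain ⟨C, hC⟩ := sonine_gamma_bound ν hν
  have hs := ((Real.summable_pow_div_factorial ((r/2)^2)).mul_left (C * (r/2)^ν.re))
  refine Summable.of_nonneg_of_le (fun _ => norm_nonneg _) (fun k => ?_) hs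
  have hr2 : 0 < r / 2 := by positivity
  have e : ‖(r / 2 : ℂ) ^ (2 * (k : ℂ) + ν)‖ = ((r/2)^2)^k * (r/2)^ν.re := by
    have : (r / 2 : ℂ) = ((r/2 : ℝ) : ℂ) := by push_cast; rfl
    rw [this, Complex.norm_cpow_eq_rpow_re_of_pos hr2]
    have : (2 * (k : ℂ) + ν).re = ((2 * k : ℕ) : ℝ) + ν.re := by simp
    rw [this, Real.rpow_add hr2, Real.rpow_natCast, pow_mul]
  rw [norm_mul, e, norm_div, norm_mul, norm_pow, norm_neg, norm_one, one_pow, Complex.norm_natCast,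
    one_div, mul_inv]
  have := hC k
  calc ((k.factorial : ℝ)⁻¹ * ‖Complex.Gamma (ν + k + 1)‖⁻¹) * (((r/2)^2)^k * (r/2)^ν.re)
      ≤ ((k.factorial : ℝ)⁻¹ * C) * (((r/2)^2)^k * (r/2)^ν.re) := by gcongr
    _ = _ := by rw [div_eq_mul_inv]; ring

/-- Sonine's first finite integral: for `r > 0`, `Re ν > -1`, `Re α > -1`,
`∫₀¹ s^{ν+1} (1-s²)^α J_ν(rs) ds = 2^α Γ(α+1) r^{-(α+1)} J_{ν+α+1}(r)`. -/
theorem sonine_first_finite_integral (r : ℝ) (hr : 0 < r)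
    (ν α : ℂ) (hν : -1 < ν.re) (hα : -1 < α.re) :
    ∫ s in (0:ℝ)..1, (s : ℂ) ^ (ν + 1) * ((1 - s ^ 2 : ℝ) : ℂ) ^ α * besselJ ν (r * s)
      = (2 : ℂ) ^ α * Complex.Gamma (α + 1) * (r : ℂ) ^ (-(α + 1)) *
        besselJ (ν + α + 1) r := by
  set c : ℕ → ℂ := fun k => ((-1) ^ k / ((Nat.factorial k : ℂ) * Complex.Gamma (ν + k + 1))) *
      ((r / 2 : ℂ) ^ (2 * (k : ℂ) + ν)) with hc
  have hcs : Summable fun k => ‖c k‖ := sonine_coeff_summable r hr ν hν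
  set h : ℕ → ℝ → ℂ := fun k s =>
    (s : ℂ) ^ (2 * (ν + k + 1) - 1) * ((1 - s ^ 2 : ℝ) : ℂ) ^ ((α + 1) - 1) with hh
  have hνk : ∀ k : ℕ, 0 < (ν + k + 1).re := by
    intro k
    have hk : (0:ℝ) ≤ k := k.cast_nonneg
    simp; linarith
  have hα1 : 0 < (α + 1).re := by simp; linarith
  have hb := fun k : ℕ => sonine_base (ν + k + 1) (α + 1) (hνk k) hα1
  have hint : ∀ k, IntegrableOn (h k) (Ioo 0 1) := fun k => (hb k).1
  have hle : ∀ k, ∫ s in Ioo (0:ℝ) 1, ‖c k * h k s‖ ≤ ‖c k‖ * ∫ s in Ioo (0:ℝ) 1, ‖h 0 s‖ := by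
    intro k
    rw [← integral_const_mul]
    refine setIntegral_mono_on ((hint k).const_mul _).norm ((hint 0).norm.const_mul _)
      measurableSet_Ioo fun s hs => ?_
    rw [norm_mul]
    refine mul_le_mul_of_nonneg_left ?_ (norm_nonneg _)
    simp only [hh]
    rw [norm_mul, norm_mul]
    refine mul_le_mul_of_nonneg_right ?_ (norm_nonneg _)
    rw [Complex.norm_cpow_eq_rpow_re_of_pos hs.1, Complex.norm_cpow_eq_rpow_re_of_pos hs.1]
    apply Real.rpow_le_rpow_of_exponent_ge hs.1 hs.2.le
    simp
  have hsum := hasSum_integral_of_summable_integral_norm (μ := volume.restrict (Ioo (0:ℝ) 1))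
    (F := fun k s => c k * h k s) (fun k => (hint k).const_mul _)
    (Summable.of_nonneg_of_le (fun _ => integral_nonneg fun _ => norm_nonneg _) hle
      (hcs.mul_right _))
  have hL : ∫ s in (0:ℝ)..1, (s : ℂ) ^ (ν + 1) * ((1 - s ^ 2 : ℝ) : ℂ) ^ α * besselJ ν (r * s)
      = ∫ s in Ioo (0:ℝ) 1, ∑' k, c k * h k s := by
    rw [intervalIntegral.integral_of_le zero_le_one, integral_Ioc_eq_integral_Ioo]
    refine setIntegral_congr_fun measurableSet_Ioo fun s hs => ?_
    simp only [besselJ]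
    rw [← tsum_mul_left]
    refine tsum_congr fun k => ?_
    have hs0 : (s : ℂ) ≠ 0 := by exact_mod_cast hs.1.ne'
    have e1 : (((r * s : ℝ) : ℂ) / 2) ^ (2 * (k:ℂ) + ν)
        = (r / 2 : ℂ) ^ (2 * (k : ℂ) + ν) * (s : ℂ) ^ (2 * (k : ℂ) + ν) := by
      have : ((r * s : ℝ) : ℂ) / 2 = ((r / 2 : ℝ) : ℂ) * (s : ℂ) := by push_cast; ring
      rw [this, Complex.mul_cpow_ofReal_nonneg (by positivity) hs.1.le]
      push_cast; rfl
    have e2 : (s : ℂ) ^ (2 * (ν + k + 1) - 1) = (s : ℂ) ^ (ν + 1) * (s : ℂ) ^ (2 * (k : ℂ) + ν) := by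
      rw [← Complex.cpow_add _ _ hs0]; congr 1; ring
    simp only [hc, hh]
    rw [e1, e2, add_sub_cancel_right]
    ring
  rw [hL, ← hsum.tsum_eq, besselJ, ← tsum_mul_left]
  refine tsum_congr fun k => ?_
  have hi : ∫ s in Ioo (0:ℝ) 1, c k * h k s = c k * (Complex.betaIntegral (ν + k + 1) (α + 1) / 2) := by
    rw [integral_const_mul, ← (hb k).2]
  rw [hi, Complex.betaIntegral_eq_Gamma_mul_div _ _ (hνk k) hα1]
  have hg := Complex.Gamma_ne_zero_of_re_pos (hνk k)
  have hg2 : Complex.Gamma (ν + k + 1 + (α + 1)) ≠ 0 :=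
    Complex.Gamma_ne_zero_of_re_pos (by rw [Complex.add_re]; linarith [hνk k])
  have hr0 : (r : ℂ) ≠ 0 := by exact_mod_cast hr.ne'
  have e3 : ν + α + 1 + k + 1 = ν + k + 1 + (α + 1) := by ring
  have e4 : (r / 2 : ℂ) ^ (2 * (k : ℂ) + (ν + α + 1))
      = (r / 2 : ℂ) ^ (2 * (k : ℂ) + ν) * ((r : ℂ) ^ (α + 1) / (2 ^ α * 2)) := by
    rw [show 2 * (k : ℂ) + (ν + α + 1) = (2 * (k : ℂ) + ν) + (α + 1) by ring,
      Complex.cpow_add _ _ (div_ne_zero hr0 two_ne_zero)]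
    congr 1
    have : (r : ℂ) ^ (α + 1) = (r / 2 : ℂ) ^ (α + 1) * 2 ^ (α + 1) := by
      have h2 := Complex.mul_cpow_ofReal_nonneg (a := r / 2) (b := 2) (by positivity) (by norm_num) (α + 1)
      push_cast at h2
      rw [← h2, div_mul_cancel₀ _ two_ne_zero]
    rw [this, Complex.cpow_add _ 1 two_ne_zero, Complex.cpow_one]
    have : (2:ℂ) ^ α ≠ 0 := by simp [Complex.cpow_eq_zero_iff]
    field_simp
  have h2a : (2:ℂ) ^ α ≠ 0 := by simp [Complex.cpow_eq_zero_iff]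
  have hra : (r:ℂ) ^ (α + 1) ≠ 0 := by simp [Complex.cpow_eq_zero_iff, hr0]
  have hk : (k.factorial : ℂ) ≠ 0 := by exact_mod_cast k.factorial_ne_zero
  rw [e3, e4, Complex.cpow_neg]
  simp only [hc]
  field_simp
end
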